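/- arXiv:2110.13147 — 3 statements merged into one kernel-verified Lean document; each statement's English description precedes it below -/
import Mathlib

section
/- Let α ∈ (0,1], T > 0, let a : [0,T] → ℝ be continuous, and consider f(t,x) = a(t)·x. Let x₁ and x₂ be solutions on [0,T] of the corresponding Caputo fractional initial value problems with initial values x₁(0) ≠ x₂(0). Then for all t ∈ [0,T]: |x₂(t) − x₁(t)| ≤ |x₂(0) − x₁(0)| · E_α(a^*(t) t^α), where a^*(t) := max_{τ ∈ [0,t]} a(τ). -/
open Set intervalIntegral

/-- The one-parameter Mittag-Leffler function `E_α(x) = ∑_{k=0}^∞ x^k / Γ(αk+1)`. -/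
noncomputable def mittagLeffler (α x : ℝ) : ℝ :=
  ∑' k : ℕ, x ^ k / Real.Gamma (α * (k : ℝ) + 1)

/-- A continuous function `x` on `[0,T]` solves the Caputo fractional initial value
problem `^C D^α_{0+} x(t) = f(t,x(t))`, `x(0) = x₀`, in the equivalent Volterra
integral formulation. -/
def IsCaputoSolution (α T : ℝ) (f : ℝ → ℝ → ℝ) (x₀ : ℝ) (x : ℝ → ℝ) : Prop :=
  ContinuousOn x (Set.Icc 0 T) ∧
    ∀ t ∈ Set.Icc 0 T,
      x t = x₀ + (1 / Real.Gamma α) * ∫ s in (0:ℝ)..t, (t - s) ^ (α - 1) * f s (x s)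

namespace CaputoLinear

open MeasureTheory Filter Topology

lemma exp_neg_mul_rpow_le_Gamma {R x : ℝ} (hR : 0 < R) (hx : 1 ≤ x) :
    Real.exp (-R) * R ^ (x - 1) ≤ Real.Gamma x := by
  have hx0 : 0 < x := by linarith
  have hsub : Ioi R ⊆ Ioi 0 := Ioi_subset_Ioi hR.le
  rw [Real.Gamma_eq_integral hx0, ← integral_exp_neg_Ioi R, ← MeasureTheory.integral_mul_const]
  calc ∫ u in Ioi R, Real.exp (-u) * R ^ (x - 1)
      ≤ ∫ u in Ioi R, Real.exp (-u) * u ^ (x - 1) := by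
        refine setIntegral_mono_on ((integrableOn_exp_neg_Ioi R).mul_const _)
          ((Real.GammaIntegral_convergent hx0).mono_set hsub) measurableSet_Ioi fun u hu => ?_
        have : R ≤ u := le_of_lt hu
        gcongr
    _ ≤ ∫ u in Ioi 0, Real.exp (-u) * u ^ (x - 1) := by
        refine setIntegral_mono_set (Real.GammaIntegral_convergent hx0) ?_ hsub.eventuallyLE
        refine (ae_restrict_iff' measurableSet_Ioi).2 (ae_of_all _ fun u hu => ?_)
        exact mul_nonneg (Real.exp_pos _).le (Real.rpow_nonneg (le_of_lt hu) _)

/-- The two-parameter Mittag-Leffler function `E_{α,β}`. -/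
noncomputable def mlSeries (α β z : ℝ) : ℝ :=
  ∑' k : ℕ, z ^ k / Real.Gamma (α * (k : ℝ) + β)

variable {α β : ℝ}

lemma Gamma_coeff_pos (hα : 0 < α) (hβ : 0 < β) (k : ℕ) : 0 < Real.Gamma (α * (k : ℝ) + β) :=
  Real.Gamma_pos_of_pos (by positivity)

lemma summable_mlSeries (hα : 0 < α) (hβ : 0 < β) (z : ℝ) :
    Summable fun k : ℕ => z ^ k / Real.Gamma (α * (k : ℝ) + β) := by
  set B : ℝ := 2 * |z| + 1 with hB
  have hB0 : 0 < B := by positivity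
  set R : ℝ := B ^ (1 / α)
  have hR : 0 < R := by positivity
  have hRpow : ∀ k : ℕ, R ^ (α * k + β - 1) = B ^ k * R ^ (β - 1) := fun k => by
    rw [add_sub_assoc, Real.rpow_add hR, ← Real.rpow_mul hB0.le, ← mul_assoc,
      one_div_mul_cancel hα.ne', one_mul, Real.rpow_natCast]
  have hz : |z| / B ≤ 1 / 2 := by
    rw [div_le_div_iff₀ hB0 two_pos]; linarith
  refine Summable.of_norm_bounded_eventually_nat
    (g := fun k : ℕ => (Real.exp (-R) * R ^ (β - 1))⁻¹ * (1 / 2 : ℝ) ^ k)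
    (summable_geometric_two.mul_left _) ?_
  have hlarge : ∀ᶠ k : ℕ in atTop, 1 ≤ α * (k : ℝ) + β :=
    (tendsto_atTop_add_const_right _ _
      (tendsto_natCast_atTop_atTop.const_mul_atTop hα)).eventually_ge_atTop 1
  filter_upwards [hlarge] with k hk
  have hG := exp_neg_mul_rpow_le_Gamma hR hk
  rw [hRpow] at hG
  rw [norm_div, norm_pow, Real.norm_eq_abs, Real.norm_eq_abs,
    abs_of_pos (Gamma_coeff_pos hα hβ k)]
  calc |z| ^ k / Real.Gamma (α * k + β)
      ≤ |z| ^ k / (Real.exp (-R) * (B ^ k * R ^ (β - 1))) := by gcongr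
    _ = (Real.exp (-R) * R ^ (β - 1))⁻¹ * (|z| / B) ^ k := by
        rw [div_pow]; field_simp
    _ ≤ _ := by gcongr

lemma continuous_mlSeries (hα : 0 < α) (hβ : 0 < β) : Continuous (mlSeries α β) := by
  refine continuous_iff_continuousAt.2 fun z => ?_
  have hc : ContinuousOn (mlSeries α β) (Metric.ball 0 (|z| + 1)) := by
    refine continuousOn_tsum (u := fun k : ℕ => (|z| + 1) ^ k / Real.Gamma (α * (k : ℝ) + β))
      (fun k => by fun_prop) (summable_mlSeries hα hβ _) fun k y hy => ?_
    have hy' : |y| ≤ |z| + 1 := by simpa using (mem_ball_zero_iff.1 hy).le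
    have := Gamma_coeff_pos hα hβ k
    rw [norm_div, norm_pow, Real.norm_eq_abs, Real.norm_eq_abs, abs_of_pos this]
    gcongr
  exact hc.continuousAt (Metric.isOpen_ball.mem_nhds (by simp))

lemma mlSeries_zero : mlSeries α β 0 = 1 / Real.Gamma β := by
  rw [mlSeries, tsum_eq_single 0 fun k hk => by simp [hk]]
  simp

/-- The kernel `t ^ (β - 1) E_{α,β}(A t ^ α)`. -/
noncomputable def mlKernel (α β A t : ℝ) : ℝ :=
  t ^ (β - 1) * mlSeries α β (A * t ^ α)

lemma continuous_mlSeries_comp (hα : 0 < α) (hβ : 0 < β) (A : ℝ) :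
    Continuous fun t : ℝ => mlSeries α β (A * t ^ α) :=
  (continuous_mlSeries hα hβ).comp
    (continuous_const.mul (Real.continuous_rpow_const hα.le))

lemma continuousOn_mlKernel (hα : 0 < α) (hβ : 0 < β) (A : ℝ) :
    ContinuousOn (mlKernel α β A) (Ioi 0) :=
  (continuousOn_id.rpow_const fun _ hx => Or.inl (ne_of_gt hx)).mul
    (continuous_mlSeries_comp hα hβ A).continuousOn

lemma intervalIntegrable_mlKernel (hα : 0 < α) (hβ : 0 < β) (A t : ℝ) :
    IntervalIntegrable (mlKernel α β A) volume 0 t :=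
  (intervalIntegrable_rpow' (by linarith)).mul_continuousOn
    (continuous_mlSeries_comp hα hβ A).continuousOn

lemma integral_rpow_mul_rpow {t : ℝ} (hα : 0 < α) (hβ : 0 < β) (ht : 0 < t) :
    ∫ s in (0 : ℝ)..t, (t - s) ^ (α - 1) * s ^ (β - 1)
      = t ^ (α + β - 1) * (Real.Gamma α * Real.Gamma β / Real.Gamma (α + β)) := by
  have h := Complex.betaIntegral_scaled (β : ℂ) (α : ℂ) ht
  rw [Complex.betaIntegral_eq_Gamma_mul_div _ _ (by simpa) (by simpa)] at h
  have hl : ∫ x in (0 : ℝ)..t, (x : ℂ) ^ ((β : ℂ) - 1) * ((t : ℂ) - x) ^ ((α : ℂ) - 1)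
      = ((∫ s in (0 : ℝ)..t, (t - s) ^ (α - 1) * s ^ (β - 1) : ℝ) : ℂ) := by
    rw [← intervalIntegral.integral_ofReal]
    refine intervalIntegral.integral_congr fun s hs => ?_
    rw [uIcc_of_le ht.le] at hs
    have h1 : 0 ≤ t - s := sub_nonneg.2 hs.2
    push_cast [Complex.ofReal_cpow h1, Complex.ofReal_cpow hs.1]
    ring
  rw [hl] at h
  apply Complex.ofReal_injective
  rw [h]
  push_cast [Complex.ofReal_cpow ht.le, ← Complex.Gamma_ofReal]
  rw [add_comm (β : ℂ), mul_comm (Complex.Gamma β)]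

lemma intervalIntegrable_rpow_mul_rpow {t : ℝ} (hα : 0 < α) (hβ : 0 < β) (ht : 0 < t) :
    IntervalIntegrable (fun s => (t - s) ^ (α - 1) * s ^ (β - 1)) volume 0 t := by
  apply intervalIntegrable_of_integral_ne_zero
  rw [integral_rpow_mul_rpow hα hβ ht]
  have := Real.Gamma_pos_of_pos hα
  have := Real.Gamma_pos_of_pos hβ
  have := Real.Gamma_pos_of_pos (add_pos hα hβ)
  positivity

lemma intervalIntegrable_rpow_mul_mlKernel {t : ℝ} (hα : 0 < α) (hβ : 0 < β) (A : ℝ)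
    (ht : 0 < t) :
    IntervalIntegrable (fun s => (t - s) ^ (α - 1) * mlKernel α β A s) volume 0 t := by
  simp only [mlKernel, ← mul_assoc]
  exact (intervalIntegrable_rpow_mul_rpow hα hβ ht).mul_continuousOn
    (continuous_mlSeries_comp hα hβ A).continuousOn

lemma rpow_mul_coeff {s : ℝ} (hs : 0 < s) (A : ℝ) (k : ℕ) :
    s ^ (β - 1) * ((A * s ^ α) ^ k / Real.Gamma (α * k + β))
      = A ^ k / Real.Gamma (α * k + β) * s ^ (α * k + β - 1) := by
  rw [mul_pow, ← Real.rpow_mul_natCast hs.le, add_sub_assoc, Real.rpow_add hs]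
  ring

/-- `mlKernel α β A` solves the Volterra equation with forcing term `t ^ (β - 1) / Γ(β)`. -/
lemma mlKernel_eq {t : ℝ} (hα : 0 < α) (hβ : 0 < β) (A : ℝ) (ht : 0 < t) :
    mlKernel α β A t = t ^ (β - 1) / Real.Gamma β
      + A / Real.Gamma α * ∫ s in (0 : ℝ)..t, (t - s) ^ (α - 1) * mlKernel α β A s := by
  have hGα := Real.Gamma_pos_of_pos hα
  let F : ℕ → ℝ → ℝ := fun k s =>
    A ^ k / Real.Gamma (α * k + β) * ((t - s) ^ (α - 1) * s ^ (α * k + β - 1))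
  have hb : ∀ k : ℕ, 0 < α * k + β := fun k => by positivity
  have hFint : ∀ k, IntegrableOn (F k) (Ioc 0 t) := fun k =>
    (intervalIntegrable_iff_integrableOn_Ioc_of_le ht.le).1
      ((intervalIntegrable_rpow_mul_rpow hα (hb k) ht).const_mul _)
  have hexp : ∀ k : ℕ, α + (α * k + β) = α * ((k + 1 : ℕ) : ℝ) + β := fun k => by
    push_cast; ring
  have hI : ∀ (C : ℝ) (k : ℕ), ∫ s in Ioc 0 t,
      C ^ k / Real.Gamma (α * k + β) * ((t - s) ^ (α - 1) * s ^ (α * k + β - 1))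
      = t ^ (α + β - 1) * Real.Gamma α *
        ((C * t ^ α) ^ k / Real.Gamma (α * ((k + 1 : ℕ) : ℝ) + β)) := fun C k => by
    rw [MeasureTheory.integral_const_mul, ← intervalIntegral.integral_of_le ht.le,
      integral_rpow_mul_rpow hα (hb k) ht, hexp, mul_pow, ← Real.rpow_mul_natCast ht.le,
      show α * ((k + 1 : ℕ) : ℝ) + β - 1 = (α + β - 1) + α * k by push_cast; ring,
      Real.rpow_add ht]
    have := Gamma_coeff_pos hα hβ k
    field_simp
  have hsum : ∀ z : ℝ, Summable fun k : ℕ => z ^ k / Real.Gamma (α * ((k + 1 : ℕ) : ℝ) + β) :=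
    fun z => by
      refine (summable_mlSeries hα (add_pos hα hβ) z).congr fun k => ?_
      rw [← hexp]; ring_nf
  have hnorm : ∀ k, ∫ s in Ioc 0 t, ‖F k s‖ = t ^ (α + β - 1) * Real.Gamma α *
        ((|A| * t ^ α) ^ k / Real.Gamma (α * ((k + 1 : ℕ) : ℝ) + β)) := fun k => by
    rw [← hI |A| k]
    refine setIntegral_congr_fun measurableSet_Ioc fun s hs => ?_
    have h1 : 0 ≤ t - s := sub_nonneg.2 hs.2
    have h2 := Gamma_coeff_pos hα hβ k
    have h3 : 0 ≤ (t - s) ^ (α - 1) * s ^ (α * k + β - 1) :=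
      mul_nonneg (Real.rpow_nonneg h1 _) (Real.rpow_nonneg hs.1.le _)
    simp only [F, Real.norm_eq_abs, abs_mul, abs_div, abs_pow, abs_of_pos h2]
    rw [← abs_mul, abs_of_nonneg h3]
  have hmain := hasSum_integral_of_summable_integral_norm hFint
    (((hsum (|A| * t ^ α)).mul_left _).congr fun k => (hnorm k).symm)
  have hlhs : ∫ s in (0 : ℝ)..t, (t - s) ^ (α - 1) * mlKernel α β A s
      = ∫ s in Ioc 0 t, ∑' k, F k s := by
    rw [intervalIntegral.integral_of_le ht.le]
    refine setIntegral_congr_fun measurableSet_Ioc fun s hs => ?_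
    simp only [F, mlKernel, mlSeries]
    rw [← tsum_mul_left, ← tsum_mul_left]
    refine tsum_congr fun k => ?_
    rw [rpow_mul_coeff hs.1]; ring
  rw [hlhs, ← hmain.tsum_eq]
  simp only [F, hI]
  rw [tsum_mul_left, mlKernel, mlSeries, (summable_mlSeries hα hβ _).tsum_eq_zero_add]
  have hshift : ∑' k : ℕ, (A * t ^ α) ^ (k + 1) / Real.Gamma (α * ((k + 1 : ℕ) : ℝ) + β)
      = A * t ^ α * ∑' k : ℕ, (A * t ^ α) ^ k / Real.Gamma (α * ((k + 1 : ℕ) : ℝ) + β) := by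
    rw [← tsum_mul_left]
    exact tsum_congr fun k => by ring
  rw [hshift, show α + β - 1 = α + (β - 1) by ring, Real.rpow_add ht]
  simp only [pow_zero, Nat.cast_zero, mul_zero, zero_add]
  field_simp

lemma integral_nonneg_of_Ioo {f : ℝ → ℝ} {a b : ℝ} (hab : a ≤ b)
    (hf : ∀ s ∈ Ioo a b, 0 ≤ f s) : 0 ≤ ∫ s in a..b, f s := by
  rw [intervalIntegral.integral_of_le hab, integral_Ioc_eq_integral_Ioo]
  exact setIntegral_nonneg measurableSet_Ioo hf

lemma forall_pos_of_step {φ : ℝ → ℝ} {T : ℝ} (hφ : ContinuousOn φ (Icc 0 T))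
    (hstep : ∀ t ∈ Icc 0 T, (∀ s ∈ Ico 0 t, 0 < φ s) → 0 < φ t) :
    ∀ t ∈ Icc 0 T, 0 < φ t := by
  by_contra! ⟨t, ht, hφt⟩
  have hcpt : IsCompact (Icc 0 T ∩ φ ⁻¹' Iic 0) :=
    isCompact_Icc.of_isClosed_subset (hφ.preimage_isClosed_of_isClosed isClosed_Icc isClosed_Iic)
      inter_subset_left
  obtain ⟨t₀, ⟨ht₀, hφt₀⟩, hleast⟩ := hcpt.exists_isLeast ⟨t, ht, hφt⟩
  refine (hstep t₀ ht₀ fun s hs => ?_).not_ge hφt₀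
  by_contra! hs'
  exact hs.2.not_ge (hleast ⟨⟨hs.1, hs.2.le.trans ht₀.2⟩, hs'⟩)

lemma integral_sub_rpow {t t' : ℝ} (hα : 0 < α) :
    ∫ s in t..t', (t' - s) ^ (α - 1) = (t' - t) ^ α / α := by
  rw [intervalIntegral.integral_comp_sub_left (fun y => y ^ (α - 1)), sub_self,
    integral_rpow (Or.inl (by linarith))]
  simp [hα.ne']

lemma sub_rpow_le_mul_sub_rpow {s t t' : ℝ} (hαβ : α ≤ β) (hβ1 : β ≤ 1)
    (hs : 0 ≤ s) (hst : s < t) (htt' : t ≤ t') :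
    (t' - s) ^ (α - 1) ≤ (t' / t) ^ (β - 1) * (t - s) ^ (α - 1) := by
  have ht : 0 < t := hs.trans_lt hst
  have h1 : 0 < t - s := sub_pos.2 hst
  have h2 : 0 < t' - s := by linarith
  have h3 : 1 ≤ t' / t := (one_le_div ht).2 htt'
  rw [← div_le_iff₀ (by positivity), ← Real.div_rpow h2.le h1.le]
  calc ((t' - s) / (t - s)) ^ (α - 1) ≤ (t' / t) ^ (α - 1) := by
        refine Real.rpow_le_rpow_of_nonpos (by positivity) ?_ (by linarith)
        rw [div_le_div_iff₀ ht h1]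
        nlinarith
    _ ≤ (t' / t) ^ (β - 1) := Real.rpow_le_rpow_of_exponent_le h3 (by linarith)

lemma mlKernel_pos_of_pos_before {A t' : ℝ} (hα : 0 < α) (hαβ : α ≤ β) (hβ1 : β ≤ 1)
    (ht' : 0 < t') (hpos : ∀ s ∈ Ioo 0 t', 0 < mlKernel α β A s) :
    0 < mlKernel α β A t' := by
  have hβ : 0 < β := hα.trans_le hαβ
  have hGα := Real.Gamma_pos_of_pos hα
  have hGβ := Real.Gamma_pos_of_pos hβ
  set e := mlKernel α β A with he
  rcases le_or_gt 0 A with hA | hA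
  · rw [he, mlKernel_eq hα hβ A ht']
    have hI : 0 ≤ ∫ s in (0 : ℝ)..t', (t' - s) ^ (α - 1) * mlKernel α β A s :=
      integral_nonneg_of_Ioo ht'.le fun s hs =>
        mul_nonneg (Real.rpow_nonneg (sub_nonneg.2 hs.2.le) _) (hpos s hs).le
    positivity
  by_contra! hneg
  set l : ℝ := -(A / Real.Gamma α) with hl
  have hl0 : 0 < l := neg_pos.2 (div_neg_of_neg_of_pos hA hGα)
  obtain ⟨η, hη1, hη2, hη0⟩ : ∃ η : ℝ, l * (η ^ α / α) < 1 / 2 ∧ η < t' / 2 ∧ 0 < η := by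
    have hc : Tendsto (fun η : ℝ => l * (η ^ α / α)) (𝓝[>] 0) (𝓝 0) := by
      have : Continuous fun η : ℝ => l * (η ^ α / α) :=
        continuous_const.mul ((Real.continuous_rpow_const hα.le).div_const _)
      have h := this.tendsto 0
      simp only [Real.zero_rpow hα.ne', zero_div, mul_zero] at h
      exact h.mono_left nhdsWithin_le_nhds
    exact ((hc.eventually_lt_const (by norm_num : (0 : ℝ) < 1 / 2)).and
      ((eventually_nhdsWithin_of_eventually_nhds (eventually_lt_nhds (half_pos ht'))).and
        eventually_mem_nhdsWithin)).exists
  have hcont : ContinuousOn e (Icc (t' - η) t') :=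
    (continuousOn_mlKernel hα hβ A).mono fun s hs => show 0 < s by linarith [hs.1]
  obtain ⟨t, ht, htmax⟩ := isCompact_Icc.exists_isMaxOn (nonempty_Icc.2 (by linarith)) hcont
  have het : 0 < e t := (hpos (t' - η) ⟨by linarith, by linarith⟩).trans_le
    (htmax ⟨le_rfl, by linarith⟩)
  have htt' : t < t' := lt_of_le_of_ne ht.2 fun h => by rw [h] at het; linarith
  have ht0 : 0 < t := by linarith [ht.1]
  set ρ : ℝ := (t' / t) ^ (β - 1) with hρ
  have hρ_half : 1 / 2 ≤ ρ := by
    have h1 : 1 ≤ t' / t := (one_le_div ht0).2 htt'.le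
    calc (1 / 2 : ℝ) ≤ (t' / t) ^ (-1 : ℝ) := by
          rw [Real.rpow_neg_one, inv_div, div_le_div_iff₀ two_pos ht']
          linarith [ht.1]
      _ ≤ ρ := Real.rpow_le_rpow_of_exponent_le h1 (by linarith)
  have hint' := intervalIntegrable_rpow_mul_mlKernel hα hβ A ht'
  have hint₁ : IntervalIntegrable (fun s => (t' - s) ^ (α - 1) * e s) volume 0 t :=
    hint'.mono_set (by
      rw [uIcc_of_le ht0.le, uIcc_of_le ht'.le]; exact Icc_subset_Icc_right htt'.le)
  have hint₂ : IntervalIntegrable (fun s => (t' - s) ^ (α - 1) * e s) volume t t' :=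
    hint'.mono_set (by rw [uIcc_of_le htt'.le, uIcc_of_le ht'.le]; exact Icc_subset_Icc_left ht0.le)
  have hI₁ : ∫ s in (0 : ℝ)..t, (t' - s) ^ (α - 1) * e s
      ≤ ρ * ∫ s in (0 : ℝ)..t, (t - s) ^ (α - 1) * e s := by
    rw [← intervalIntegral.integral_const_mul]
    refine intervalIntegral.integral_mono_on_of_le_Ioo ht0.le hint₁
      ((intervalIntegrable_rpow_mul_mlKernel hα hβ A ht0).const_mul _) fun s hs => ?_
    rw [← mul_assoc]
    exact mul_le_mul_of_nonneg_right (sub_rpow_le_mul_sub_rpow hαβ hβ1 hs.1.le hs.2 htt'.le)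
      (hpos s ⟨hs.1, hs.2.trans htt'⟩).le
  have hI₂ : ∫ s in t..t', (t' - s) ^ (α - 1) * e s ≤ (η ^ α / α) * e t := by
    calc ∫ s in t..t', (t' - s) ^ (α - 1) * e s
        ≤ ∫ s in t..t', (t' - s) ^ (α - 1) * e t := by
          refine intervalIntegral.integral_mono_on_of_le_Ioo htt'.le hint₂ ?_ fun s hs => ?_
          · have : IntervalIntegrable (fun y : ℝ => y ^ (α - 1)) volume (t' - t) (t' - t') :=
              intervalIntegrable_rpow' (by linarith)
            simpa using (this.comp_sub_left t').mul_const (e t)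
          · exact mul_le_mul_of_nonneg_left (htmax ⟨ht.1.trans hs.1.le, hs.2.le⟩)
              (Real.rpow_nonneg (sub_nonneg.2 hs.2.le) _)
      _ = (t' - t) ^ α / α * e t := by
          rw [intervalIntegral.integral_mul_const, integral_sub_rpow hα]
      _ ≤ _ := by
          have : t' - t ≤ η := by linarith [ht.1]
          have : 0 ≤ t' - t := by linarith
          gcongr
  have h1 := mlKernel_eq hα hβ A ht'
  have h2 := mlKernel_eq hα hβ A ht0
  rw [← intervalIntegral.integral_add_adjacent_intervals hint₁ hint₂] at h1
  have hf : t' ^ (β - 1) / Real.Gamma β = ρ * (t ^ (β - 1) / Real.Gamma β) := by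
    rw [hρ, Real.div_rpow ht'.le ht0.le]
    have : 0 < t ^ (β - 1) := by positivity
    field_simp
  have hAl : A / Real.Gamma α = -l := by rw [hl, neg_neg]
  rw [← he, hf, hAl] at h1
  rw [← he, hAl] at h2
  have h3 : 0 < (ρ - l * (η ^ α / α)) * e t := mul_pos (by linarith) het
  have h4 := mul_le_mul_of_nonneg_left (add_le_add hI₁ hI₂) hl0.le
  have h5 := congrArg (ρ * ·) h2
  linarith

lemma mlSeries_pos {A t : ℝ} (hα : 0 < α) (hαβ : α ≤ β) (hβ1 : β ≤ 1) (ht : 0 ≤ t) :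
    0 < mlSeries α β (A * t ^ α) := by
  have hβ : 0 < β := hα.trans_le hαβ
  refine forall_pos_of_step (T := t) (continuous_mlSeries_comp hα hβ A).continuousOn
    (fun r hr hpos => ?_) t ⟨ht, le_rfl⟩
  rcases hr.1.eq_or_lt with rfl | hr0
  · have := Real.Gamma_pos_of_pos hβ
    rw [Real.zero_rpow hα.ne', mul_zero, mlSeries_zero]
    positivity
  · have := mlKernel_pos_of_pos_before (A := A) hα hαβ hβ1 hr0 fun s hs =>
      mul_pos (Real.rpow_pos_of_pos hs.1 _) (hpos s ⟨hs.1.le, hs.2⟩)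
    exact pos_of_mul_pos_right this (by positivity)

lemma mlKernel_pos {A t : ℝ} (hα : 0 < α) (hα1 : α ≤ 1) (ht : 0 < t) : 0 < mlKernel α α A t :=
  mul_pos (Real.rpow_pos_of_pos ht _) (mlSeries_pos hα le_rfl hα1 ht.le)

lemma integral_convolution_swap {p q g : ℝ → ℝ} {t : ℝ} (ht : 0 ≤ t)
    (hp : IntervalIntegrable p volume 0 t) (hq : IntervalIntegrable q volume 0 t)
    (hg : ContinuousOn g (Icc 0 t)) :
    ∫ r in (0 : ℝ)..t, p (t - r) * ∫ s in (0 : ℝ)..r, q (r - s) * g s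
      = ∫ s in (0 : ℝ)..t, g s * ∫ y in (0 : ℝ)..(t - s), p (t - s - y) * q y := by
  set P : ℝ → ℝ := (Ioo 0 t).indicator fun r => p (t - r) with hP
  set Q : ℝ → ℝ := (Ioo 0 t).indicator q with hQ
  set G : ℝ → ℝ := (Ioo 0 t).indicator g with hG
  have hPint : Integrable P := by
    have h := hp.comp_sub_left t
    rw [sub_zero, sub_self] at h
    exact (integrable_indicator_iff measurableSet_Ioo).2
      ((intervalIntegrable_iff_integrableOn_Ioo_of_le ht).1 h.symm)
  have hQint : Integrable Q := (integrable_indicator_iff measurableSet_Ioo).2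
    ((intervalIntegrable_iff_integrableOn_Ioo_of_le ht).1 hq)
  obtain ⟨C, hC⟩ := isCompact_Icc.exists_bound_of_continuousOn hg
  have hGmeas : AEStronglyMeasurable G volume :=
    (aestronglyMeasurable_indicator_iff measurableSet_Ioo).2
      ((hg.mono Ioo_subset_Icc_self).aestronglyMeasurable measurableSet_Ioo)
  have hGbound : ∀ s, ‖G s‖ ≤ |C| := fun s => by
    by_cases hs : s ∈ Ioo 0 t
    · rw [hG, indicator_of_mem hs]
      exact (hC s (Ioo_subset_Icc_self hs)).trans (le_abs_self C)
    · rw [hG, indicator_of_notMem hs]; simp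
  have hprod : Integrable (Function.uncurry fun s r => G s * (P r * Q (r - s)))
      (volume.prod volume) := by
    have h := hPint.convolution_integrand (ContinuousLinearMap.mul ℝ ℝ) hQint.comp_neg
    simp only [ContinuousLinearMap.mul_apply', neg_sub] at h
    exact h.bdd_mul (c := |C|) hGmeas.comp_fst (ae_of_all _ fun x => hGbound x.1)
  have hswap := integral_integral_swap hprod
  have hL : ∫ r in (0 : ℝ)..t, p (t - r) * ∫ s in (0 : ℝ)..r, q (r - s) * g s
      = ∫ r, ∫ s, G s * (P r * Q (r - s)) := by
    rw [intervalIntegral.integral_of_le ht, integral_Ioc_eq_integral_Ioo,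
      ← MeasureTheory.integral_indicator measurableSet_Ioo]
    refine integral_congr_ae (ae_of_all _ fun r => ?_)
    by_cases hr : r ∈ Ioo 0 t
    · simp only [indicator_of_mem hr, hP]
      rw [intervalIntegral.integral_of_le hr.1.le, integral_Ioc_eq_integral_Ioo,
        ← MeasureTheory.integral_const_mul, ← MeasureTheory.integral_indicator measurableSet_Ioo]
      refine integral_congr_ae (ae_of_all _ fun s => ?_)
      by_cases hs : s ∈ Ioo 0 r
      · have hs1 : s ∈ Ioo 0 t := ⟨hs.1, hs.2.trans hr.2⟩
        have hs2 : r - s ∈ Ioo 0 t := ⟨sub_pos.2 hs.2, by linarith [hs.1, hr.2]⟩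
        simp only [indicator_of_mem hs, hG, hQ, indicator_of_mem hs1, indicator_of_mem hs2]
        ring
      · simp only [indicator_of_notMem hs]
        by_cases hs1 : s ∈ Ioo 0 t
        · have hs2 : r - s ∉ Ioo 0 t := fun h => hs ⟨hs1.1, sub_pos.1 h.1⟩
          simp [hQ, indicator_of_notMem hs2]
        · simp [hG, indicator_of_notMem hs1]
    · simp [hP, indicator_of_notMem hr]
  have hR : ∫ s in (0 : ℝ)..t, g s * ∫ y in (0 : ℝ)..(t - s), p (t - s - y) * q y
      = ∫ s, ∫ r, G s * (P r * Q (r - s)) := by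
    rw [intervalIntegral.integral_of_le ht, integral_Ioc_eq_integral_Ioo,
      ← MeasureTheory.integral_indicator measurableSet_Ioo]
    refine integral_congr_ae (ae_of_all _ fun s => ?_)
    by_cases hs : s ∈ Ioo 0 t
    · simp only [indicator_of_mem hs, hG, MeasureTheory.integral_const_mul]
      have hshift := intervalIntegral.integral_comp_sub_right
        (fun y => p (t - s - y) * q y) (a := s) (b := t) s
      rw [sub_self] at hshift
      rw [← hshift, intervalIntegral.integral_of_le hs.2.le, integral_Ioc_eq_integral_Ioo,
        ← MeasureTheory.integral_indicator measurableSet_Ioo]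
      congr 1
      refine integral_congr_ae (ae_of_all _ fun r => ?_)
      by_cases hr : r ∈ Ioo s t
      · have hr1 : r ∈ Ioo 0 t := ⟨hs.1.trans hr.1, hr.2⟩
        have hr2 : r - s ∈ Ioo 0 t := ⟨sub_pos.2 hr.1, by linarith [hs.1, hr.2]⟩
        simp only [indicator_of_mem hr, hP, hQ, indicator_of_mem hr1, indicator_of_mem hr2,
          sub_sub_sub_cancel_right]
      · simp only [indicator_of_notMem hr]
        by_cases hr1 : r ∈ Ioo 0 t
        · have hr2 : r - s ∉ Ioo 0 t := fun h => hr ⟨sub_pos.1 h.1, hr1.2⟩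
          simp [hQ, indicator_of_notMem hr2]
        · simp [hP, indicator_of_notMem hr1]
    · simp [hG, indicator_of_notMem hs]
  rw [hL, hR, hswap]

lemma intervalIntegrable_mlKernel_sub_mul (hα : 0 < α) (A : ℝ) {t : ℝ} (ht : 0 ≤ t)
    {g : ℝ → ℝ} (hg : ContinuousOn g (Icc 0 t)) :
    IntervalIntegrable (fun r => mlKernel α α A (t - r) * g r) volume 0 t := by
  have h := ((intervalIntegrable_mlKernel hα hα A t).comp_sub_left t).symm
  rw [sub_zero, sub_self] at h
  exact h.mul_continuousOn (by rwa [uIcc_of_le ht])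

lemma intervalIntegrable_rpow_sub_mul (hα : 0 < α) {t : ℝ} (ht : 0 ≤ t)
    {g : ℝ → ℝ} (hg : ContinuousOn g (Icc 0 t)) :
    IntervalIntegrable (fun r => (t - r) ^ (α - 1) * g r) volume 0 t := by
  have h : IntervalIntegrable (fun y : ℝ => y ^ (α - 1)) volume 0 t :=
    intervalIntegrable_rpow' (by linarith)
  have h := (h.comp_sub_left t).symm
  rw [sub_zero, sub_self] at h
  exact h.mul_continuousOn (by rwa [uIcc_of_le ht])

lemma volterra_resolvent (hα : 0 < α) {A c t : ℝ} (ht : 0 ≤ t) {w h : ℝ → ℝ}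
    (hw : ContinuousOn w (Icc 0 t)) (hh : ContinuousOn h (Icc 0 t))
    (heq : ∀ r ∈ Icc 0 t,
      w r = c + 1 / Real.Gamma α * ∫ s in (0 : ℝ)..r, (r - s) ^ (α - 1) * (A * w s + h s)) :
    w t = c * (1 + A * ∫ r in (0 : ℝ)..t, mlKernel α α A (t - r))
      + ∫ r in (0 : ℝ)..t, mlKernel α α A (t - r) * h r := by
  have hGα := Real.Gamma_pos_of_pos hα
  set e := mlKernel α α A with he
  have hg : ContinuousOn (fun s => A * w s + h s) (Icc 0 t) :=
    (continuousOn_const.mul hw).add hh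
  have hew : IntervalIntegrable (fun r => e (t - r) * w r) volume 0 t :=
    intervalIntegrable_mlKernel_sub_mul hα A ht hw
  have heh : IntervalIntegrable (fun r => e (t - r) * h r) volume 0 t :=
    intervalIntegrable_mlKernel_sub_mul hα A ht hh
  have he1 : IntervalIntegrable (fun r => e (t - r)) volume 0 t := by
    simpa using intervalIntegrable_mlKernel_sub_mul hα A ht (continuousOn_const (c := (1 : ℝ)))
  have hswap := integral_convolution_swap (p := e) (q := fun y => y ^ (α - 1)) ht
    (intervalIntegrable_mlKernel hα hα A t) (intervalIntegrable_rpow' (by linarith)) hg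
  have hleft : ∫ r in (0 : ℝ)..t, e (t - r) *
        ∫ s in (0 : ℝ)..r, (r - s) ^ (α - 1) * (A * w s + h s)
      = Real.Gamma α * ((∫ r in (0 : ℝ)..t, e (t - r) * w r)
          - c * ∫ r in (0 : ℝ)..t, e (t - r)) := by
    rw [← intervalIntegral.integral_const_mul, ← intervalIntegral.integral_sub hew
      (he1.const_mul c), ← intervalIntegral.integral_const_mul]
    refine intervalIntegral.integral_congr fun r hr => ?_
    rw [uIcc_of_le ht] at hr
    rw [heq r hr]
    field_simp
    ring
  have hright : A / Real.Gamma α * ∫ s in (0 : ℝ)..t, (A * w s + h s) *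
        ∫ y in (0 : ℝ)..(t - s), e (t - s - y) * y ^ (α - 1)
      = (A * (∫ r in (0 : ℝ)..t, e (t - r) * w r) + ∫ r in (0 : ℝ)..t, e (t - r) * h r)
        - 1 / Real.Gamma α * ∫ s in (0 : ℝ)..t, (t - s) ^ (α - 1) * (A * w s + h s) := by
    rw [← intervalIntegral.integral_const_mul, ← intervalIntegral.integral_const_mul,
      ← intervalIntegral.integral_const_mul, ← intervalIntegral.integral_add
        (hew.const_mul A) heh, ← intervalIntegral.integral_sub
        ((hew.const_mul A).add heh) ((intervalIntegrable_rpow_sub_mul hα ht hg).const_mul _),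
      intervalIntegral.integral_of_le ht, intervalIntegral.integral_of_le ht,
      integral_Ioc_eq_integral_Ioo, integral_Ioc_eq_integral_Ioo]
    refine setIntegral_congr_fun measurableSet_Ioo fun s hs => ?_
    have hts : 0 < t - s := sub_pos.2 hs.2
    have hrefl := intervalIntegral.integral_comp_sub_left
      (fun y => (t - s - y) ^ (α - 1) * e y) (a := 0) (b := t - s) (t - s)
    simp only [sub_sub_cancel, sub_self, sub_zero] at hrefl
    have hk := mlKernel_eq hα hα A hts
    rw [← he, ← hrefl] at hk
    simp only [mul_comm (e _)] at hk ⊢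
    rw [hk]
    ring
  have hwt := heq t ⟨ht, le_rfl⟩
  rw [← hswap, hleft] at hright
  have hcancel : A / Real.Gamma α * (Real.Gamma α * ((∫ r in (0 : ℝ)..t, e (t - r) * w r)
      - c * ∫ r in (0 : ℝ)..t, e (t - r)))
      = A * ((∫ r in (0 : ℝ)..t, e (t - r) * w r) - c * ∫ r in (0 : ℝ)..t, e (t - r)) := by
    field_simp
  rw [hcancel] at hright
  linarith

lemma mittagLeffler_eq (hα : 0 < α) (A : ℝ) {t : ℝ} (ht : 0 ≤ t) :
    mittagLeffler α (A * t ^ α) = 1 + A * ∫ r in (0 : ℝ)..t, mlKernel α α A (t - r) := by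
  have hker : mlKernel α 1 A = fun s => mlSeries α 1 (A * s ^ α) := by
    funext s; simp [mlKernel]
  have h := volterra_resolvent (c := 1) (A := A) (h := fun _ => 0) hα ht
    (continuous_mlSeries_comp hα one_pos A).continuousOn continuousOn_const fun r hr => by
      rcases hr.1.eq_or_lt with rfl | hr0
      · simp [Real.zero_rpow hα.ne', mlSeries_zero]
      · have hk := mlKernel_eq hα one_pos A hr0
        simp only [hker, sub_self, Real.rpow_zero, Real.Gamma_one, div_one] at hk
        rw [hk, ← intervalIntegral.integral_const_mul, ← intervalIntegral.integral_const_mul]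
        congr 2
        funext s
        ring
  simpa [mittagLeffler, mlSeries] using h

lemma variation_of_constants (hα : 0 < α) {A c t : ℝ} (ht : 0 ≤ t) {w a : ℝ → ℝ}
    (hw : ContinuousOn w (Icc 0 t)) (ha : ContinuousOn a (Icc 0 t))
    (heq : ∀ r ∈ Icc 0 t,
      w r = c + 1 / Real.Gamma α * ∫ s in (0 : ℝ)..r, (r - s) ^ (α - 1) * (a s * w s)) :
    w t = c * mittagLeffler α (A * t ^ α)
      + ∫ r in (0 : ℝ)..t, mlKernel α α A (t - r) * ((a r - A) * w r) := by
  rw [mittagLeffler_eq hα A ht]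
  refine volterra_resolvent hα ht hw ((ha.sub continuousOn_const).mul hw) fun r hr => ?_
  rw [heq r hr]
  congr 3
  funext s
  ring

variable {T c : ℝ} {a w : ℝ → ℝ}

lemma linear_solution_pos (hα : 0 < α) (hα1 : α ≤ 1) (ha : ContinuousOn a (Icc 0 T))
    (hc : 0 < c) (hw : IsCaputoSolution α T (fun t x => a t * x) c w) :
    ∀ t ∈ Icc 0 T, 0 < w t := by
  obtain ⟨C, hC⟩ := isCompact_Icc.exists_bound_of_continuousOn ha
  refine forall_pos_of_step hw.1 fun t ht hpos => ?_
  have hsub : Icc 0 t ⊆ Icc 0 T := Icc_subset_Icc_right ht.2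
  rw [variation_of_constants (A := -C) hα ht.1 (hw.1.mono hsub) (ha.mono hsub)
    fun r hr => hw.2 r (hsub hr)]
  have hE : 0 < mittagLeffler α (-C * t ^ α) := mlSeries_pos hα hα1 le_rfl ht.1
  refine add_pos_of_pos_of_nonneg (mul_pos hc hE) (integral_nonneg_of_Ioo ht.1 fun r hr => ?_)
  have haC : -C ≤ a r := (abs_le.1 (hC r (hsub (Ioo_subset_Icc_self hr)))).1
  exact mul_nonneg (mlKernel_pos hα hα1 (sub_pos.2 hr.2)).le
    (mul_nonneg (by linarith) (hpos r ⟨hr.1.le, hr.2⟩).le)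

lemma abs_linear_solution_le (hα : 0 < α) (hα1 : α ≤ 1) (ha : ContinuousOn a (Icc 0 T))
    (hc : 0 < c) (hw : IsCaputoSolution α T (fun t x => a t * x) c w) :
    ∀ t ∈ Icc 0 T, |w t| ≤ c * mittagLeffler α (sSup (a '' Icc 0 t) * t ^ α) := by
  intro t ht
  have hpos := linear_solution_pos hα hα1 ha hc hw
  have hsub : Icc 0 t ⊆ Icc 0 T := Icc_subset_Icc_right ht.2
  have hbdd : BddAbove (a '' Icc 0 t) :=
    (isCompact_Icc.image_of_continuousOn (ha.mono hsub)).bddAbove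
  rw [abs_of_pos (hpos t ht), variation_of_constants (A := sSup (a '' Icc 0 t)) hα ht.1
    (hw.1.mono hsub) (ha.mono hsub) fun r hr => hw.2 r (hsub hr)]
  have hI := integral_nonneg_of_Ioo (f := fun r => -(mlKernel α α (sSup (a '' Icc 0 t)) (t - r) *
    ((a r - sSup (a '' Icc 0 t)) * w r))) ht.1 fun r hr => by
      have har : a r ≤ sSup (a '' Icc 0 t) :=
        le_csSup hbdd (mem_image_of_mem a (Ioo_subset_Icc_self hr))
      have hk := mlKernel_pos (A := sSup (a '' Icc 0 t)) hα hα1 (sub_pos.2 hr.2)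
      exact neg_nonneg.2 (mul_nonpos_of_nonneg_of_nonpos hk.le
        (mul_nonpos_of_nonpos_of_nonneg (by linarith)
          (hpos r (hsub (Ioo_subset_Icc_self hr))).le))
  rw [intervalIntegral.integral_neg] at hI
  linarith

lemma IsCaputoSolution.sub {x₁₀ x₂₀ : ℝ} {x₁ x₂ : ℝ → ℝ} (hα : 0 < α)
    (ha : ContinuousOn a (Icc 0 T))
    (hx₁ : IsCaputoSolution α T (fun t x => a t * x) x₁₀ x₁)
    (hx₂ : IsCaputoSolution α T (fun t x => a t * x) x₂₀ x₂) :
    IsCaputoSolution α T (fun t x => a t * x) (x₂₀ - x₁₀) (fun t => x₂ t - x₁ t) := by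
  refine ⟨hx₂.1.sub hx₁.1, fun t ht => ?_⟩
  have hsub : Icc 0 t ⊆ Icc 0 T := Icc_subset_Icc_right ht.2
  have hint : ∀ {x : ℝ → ℝ}, ContinuousOn x (Icc 0 T) →
      IntervalIntegrable (fun s => (t - s) ^ (α - 1) * (a s * x s)) volume 0 t := fun hx =>
    intervalIntegrable_rpow_sub_mul hα ht.1 ((ha.mul hx).mono hsub)
  simp only [mul_sub]
  rw [intervalIntegral.integral_sub (hint hx₂.1) (hint hx₁.1), hx₁.2 t ht, hx₂.2 t ht]
  ring

end CaputoLinear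

/-- Divergence rate for solutions of one-dimensional linear FDEs:
`|x₂(t) − x₁(t)| ≤ |x₂(0) − x₁(0)| · E_α(a^*(t)·t^α)` with `a^*(t) = max_{τ∈[0,t]} a(τ)`. -/
theorem caputo_linear_upper_bound (α T : ℝ) (hα : 0 < α) (hα1 : α ≤ 1) (hT : 0 < T)
    (a : ℝ → ℝ) (ha : ContinuousOn a (Set.Icc 0 T))
    (x₁₀ x₂₀ : ℝ) (hne : x₁₀ ≠ x₂₀) (x₁ x₂ : ℝ → ℝ)
    (hx₁ : IsCaputoSolution α T (fun t x => a t * x) x₁₀ x₁)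
    (hx₂ : IsCaputoSolution α T (fun t x => a t * x) x₂₀ x₂) :
    ∀ t ∈ Set.Icc 0 T,
      |x₂ t - x₁ t|
        ≤ |x₂₀ - x₁₀| * mittagLeffler α (sSup (a '' Set.Icc 0 t) * t ^ α) := by
  intro t ht
  rcases hne.lt_or_gt with h | h
  · rw [abs_of_pos (sub_pos.2 h)]
    exact CaputoLinear.abs_linear_solution_le hα hα1 ha (sub_pos.2 h)
      (CaputoLinear.IsCaputoSolution.sub hα ha hx₁ hx₂) t ht
  · rw [abs_sub_comm, abs_sub_comm x₂₀, abs_of_pos (sub_pos.2 h)]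
    exact CaputoLinear.abs_linear_solution_le hα hα1 ha (sub_pos.2 h)
      (CaputoLinear.IsCaputoSolution.sub hα ha hx₂ hx₁) t ht
end

section
/- Let α ∈ (0,1] and let a : [0,∞) → ℝ be continuous with sup_{t ≥ 0} a(t) < 0. Then every solution x on [0,∞) of the Caputo fractional differential equation with right-hand side f(t,x) = a(t)·x satisfies lim_{t → ∞} x(t) = 0; that is, the differential equation is asymptotically stable. -/
open Set intervalIntegral

/-- A continuous function `x` on `[0,∞)` solves the Caputo fractional initial value
problem `^C D^α_{0+} x(t) = f(t,x(t))`, `x(0) = x₀`, in the equivalent Volterra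
integral formulation, on the whole half line. -/
def IsCaputoSolutionIci (α : ℝ) (f : ℝ → ℝ → ℝ) (x₀ : ℝ) (x : ℝ → ℝ) : Prop :=
  ContinuousOn x (Set.Ici 0) ∧
    ∀ t ∈ Set.Ici (0:ℝ),
      x t = x₀ + (1 / Real.Gamma α) * ∫ s in (0:ℝ)..t, (t - s) ^ (α - 1) * f s (x s)

open MeasureTheory Filter Topology

theorem intervalIntegrable_sub_rpow {α : ℝ} (hα : 0 < α) (a b c : ℝ) :
    IntervalIntegrable (fun s => (c - s) ^ (α - 1)) volume a b := by
  have h := (intervalIntegral.intervalIntegrable_rpow' (a := c - a) (b := c - b)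
    (r := α - 1) (by linarith)).comp_sub_left c
  simpa using h

theorem integral_sub_rpow {α : ℝ} (hα : 0 < α) (a t : ℝ) :
    ∫ s in a..t, (t - s) ^ (α - 1) = (t - a) ^ α / α := by
  rw [intervalIntegral.integral_comp_sub_left (fun u => u ^ (α - 1)),
    integral_rpow (Or.inl (by linarith))]
  simp [Real.zero_rpow hα.ne']

theorem intervalIntegrable_sub_rpow_mul {α : ℝ} (hα : 0 < α) {f : ℝ → ℝ}
    (hf : ContinuousOn f (Ici 0)) {a b : ℝ} (ha : 0 ≤ a) (hb : 0 ≤ b) (c : ℝ) :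
    IntervalIntegrable (fun s => (c - s) ^ (α - 1) * f s) volume a b := by
  refine (intervalIntegrable_sub_rpow hα a b c).mul_continuousOn (hf.mono ?_)
  intro y hy
  exact (le_min ha hb).trans hy.1

/-- A bound for the fractional integral of a function bounded above on the interval. -/
theorem integral_sub_rpow_mul_le {α : ℝ} (hα : 0 < α) {f : ℝ → ℝ}
    (hf : ContinuousOn f (Ici 0)) {a t B : ℝ} (ha : 0 ≤ a) (hat : a ≤ t)
    (hB : ∀ s ∈ Icc a t, f s ≤ B) :
    ∫ s in a..t, (t - s) ^ (α - 1) * f s ≤ B * ((t - a) ^ α / α) := by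
  rw [← integral_sub_rpow hα, mul_comm, ← intervalIntegral.integral_mul_const]
  refine intervalIntegral.integral_mono_on hat
    (intervalIntegrable_sub_rpow_mul hα hf ha (ha.trans hat) t)
    ((intervalIntegrable_sub_rpow hα a t t).mul_const B) fun s hs => ?_
  exact mul_le_mul_of_nonneg_left (hB s hs) (Real.rpow_nonneg (by linarith [hs.2]) _)

/-- A length on which the fractional integral operator has small norm. -/
theorem exists_pos_forall_mul_rpow_lt {α : ℝ} (hα : 0 < α) (M : ℝ) {g : ℝ} (hg : 0 < g) :
    ∃ d > 0, ∀ r, 0 ≤ r → r < d → M * (r ^ α / α) < g := by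
  have hc : ContinuousAt (fun r : ℝ => M * (r ^ α / α)) 0 :=
    ((Real.continuousAt_rpow_const 0 α (Or.inr hα.le)).div_const α).const_mul M
  have h0 : M * ((0 : ℝ) ^ α / α) < g := by simpa [Real.zero_rpow hα.ne'] using hg
  obtain ⟨d, hd, h⟩ := Metric.eventually_nhds_iff.1 (hc.eventually (gt_mem_nhds h0))
  refine ⟨d, hd, fun r hr hrd => h ?_⟩
  simpa [abs_of_nonneg hr] using hrd

/-- The linear Volterra equation with nonpositive coefficient preserves positivity. -/
theorem volterra_pos {α : ℝ} (hα : 0 < α) (hα1 : α ≤ 1) {a x : ℝ → ℝ} {g x₀ : ℝ}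
    (hg : 0 < g) (hx₀ : 0 < x₀) (ha : ContinuousOn a (Ici 0)) (ha0 : ∀ t, 0 ≤ t → a t ≤ 0)
    (hx : ContinuousOn x (Ici 0))
    (heq : ∀ t, 0 ≤ t → g * x t = g * x₀ + ∫ s in (0:ℝ)..t, (t - s) ^ (α - 1) * (a s * x s))
    {t : ℝ} (ht : 0 ≤ t) : 0 < x t := by
  by_contra! hneg
  have hf : ContinuousOn (fun s => a s * x s) (Ici 0) := ha.mul hx
  set S : Set ℝ := {s ∈ Icc 0 t | x s ≤ 0} with hS
  have hxt : ContinuousOn x (Icc 0 t) := hx.mono fun y hy => hy.1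
  have hScomp : IsCompact S := by
    have hcl : IsClosed S := hxt.preimage_isClosed_of_isClosed isClosed_Icc isClosed_Iic
    exact isCompact_Icc.of_isClosed_subset hcl fun y hy => hy.1
  obtain ⟨t₀, ht₀, hmin⟩ := hScomp.exists_isLeast ⟨t, ⟨ht, le_rfl⟩, hneg⟩
  obtain ⟨⟨ht₀0, ht₀t⟩, hxt₀⟩ := ht₀
  have hpos : ∀ s, 0 ≤ s → s < t₀ → 0 < x s := by
    intro s hs hst
    by_contra! h
    exact absurd (hmin ⟨⟨hs, hst.le.trans ht₀t⟩, h⟩) (not_le.2 hst)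
  have hx0 : x 0 = x₀ := by
    have := heq 0 le_rfl
    simp only [intervalIntegral.integral_same, add_zero] at this
    exact mul_left_cancel₀ hg.ne' this
  have ht₀pos : 0 < t₀ := by
    rcases ht₀0.eq_or_lt with h | h
    · rw [← h, hx0] at hxt₀; linarith
    · exact h
  obtain ⟨m, -, hm⟩ := (isCompact_Icc (a := (0:ℝ)) (b := t₀)).exists_isMaxOn
    ⟨0, le_rfl, ht₀0⟩ ((ha.mono fun y hy => hy.1).neg)
  obtain ⟨d, hd, hsmall⟩ := exists_pos_forall_mul_rpow_lt hα (-a m) hg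
  set b := max 0 (t₀ - d / 2) with hb
  have hb0 : 0 ≤ b := le_max_left _ _
  have hbt : b < t₀ := max_lt ht₀pos (by linarith)
  have hbd : t₀ - d / 2 ≤ b := le_max_right _ _
  obtain ⟨p, ⟨hp1, hp2⟩, hp⟩ := (isCompact_Icc (a := b) (b := t₀)).exists_isMaxOn
    ⟨b, le_rfl, hbt.le⟩ (hx.mono fun y hy => hb0.trans hy.1)
  have hxp : 0 < x p := (hpos b hb0 hbt).trans_le (hp ⟨le_rfl, hbt.le⟩)
  have hpt : p < t₀ := by
    rcases hp2.eq_or_lt with h | h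
    · rw [h] at hxp; linarith
    · exact h
  have hp0 : 0 ≤ p := hb0.trans hp1
  have hsplit := intervalIntegral.integral_add_adjacent_intervals
    (intervalIntegrable_sub_rpow_mul hα hf le_rfl hp0 t₀)
    (intervalIntegrable_sub_rpow_mul hα hf hp0 ht₀0 t₀)
  have hmem : ∫ s in (0:ℝ)..p, (p - s) ^ (α - 1) * (a s * x s) ≤
      ∫ s in (0:ℝ)..p, (t₀ - s) ^ (α - 1) * (a s * x s) := by
    refine intervalIntegral.integral_mono_on_of_le_Ioo hp0
      (intervalIntegrable_sub_rpow_mul hα hf le_rfl hp0 p)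
      (intervalIntegrable_sub_rpow_mul hα hf le_rfl hp0 t₀) fun s hs => ?_
    refine mul_le_mul_of_nonpos_right ?_
      (mul_nonpos_of_nonpos_of_nonneg (ha0 s hs.1.le) (hpos s hs.1.le (hs.2.trans hpt)).le)
    exact Real.rpow_le_rpow_of_nonpos (by linarith [hs.2]) (by linarith) (by linarith)
  have hloss := integral_sub_rpow_mul_le hα (f := fun s => -(a s * x s)) hf.neg hp0 hpt.le
    (B := -a m * x p) (by
      intro s hs
      have h1 : -a s ≤ -a m := hm ⟨hp0.trans hs.1, hs.2⟩
      have h2 : x s ≤ x p := hp ⟨hp1.trans hs.1, hs.2⟩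
      have h3 := ha0 s (hp0.trans hs.1)
      nlinarith)
  simp only [mul_neg, intervalIntegral.integral_neg] at hloss
  have h1 := heq t₀ ht₀0
  have h2 := heq p hp0
  have h3 := hsmall (t₀ - p) (by linarith) (by linarith)
  nlinarith

/-- The linear Volterra equation with zero initial value has only the zero solution. -/
theorem volterra_eq_zero {α : ℝ} (hα : 0 < α) {a x : ℝ → ℝ} {g : ℝ}
    (hg : 0 < g) (ha : ContinuousOn a (Ici 0)) (hx : ContinuousOn x (Ici 0))
    (heq : ∀ t, 0 ≤ t → g * x t = ∫ s in (0:ℝ)..t, (t - s) ^ (α - 1) * (a s * x s))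
    {t : ℝ} (ht : 0 ≤ t) : x t = 0 := by
  have hf : ContinuousOn (fun s => a s * x s) (Ici 0) := ha.mul hx
  obtain ⟨m, -, hm⟩ := (isCompact_Icc (a := (0:ℝ)) (b := t)).exists_isMaxOn
    ⟨0, le_rfl, ht⟩ ((ha.mono fun y hy => hy.1).abs)
  obtain ⟨d, hd, hsmall⟩ := exists_pos_forall_mul_rpow_lt hα (|a m|) hg
  have key : ∀ n : ℕ, ∀ s, 0 ≤ s → s ≤ t → s ≤ n * (d / 2) → x s = 0 := by
    intro n
    induction n with
    | zero =>
      intro s hs _ hs'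
      obtain rfl : s = 0 := le_antisymm (by simpa using hs') hs
      have := heq 0 le_rfl
      simpa [hg.ne'] using this
    | succ n ih =>
      intro s hs hst hsn
      push_cast at hsn
      by_cases hcase : s ≤ n * (d / 2)
      · exact ih s hs hst hcase
      push Not at hcase
      set b : ℝ := n * (d / 2) with hb
      have hb0 : 0 ≤ b := by positivity
      obtain ⟨p, ⟨hp1, hp2⟩, hp⟩ := (isCompact_Icc (a := b) (b := s)).exists_isMaxOn
        ⟨b, le_rfl, hcase.le⟩ ((hx.mono fun y hy => hb0.trans hy.1).abs)
      have hp0 : 0 ≤ p := hb0.trans hp1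
      have hzero : ∫ σ in (0:ℝ)..b, (p - σ) ^ (α - 1) * (a σ * x σ) = 0 := by
        rw [intervalIntegral.integral_congr (g := fun _ => (0:ℝ))]
        · simp
        · intro σ hσ
          rw [uIcc_of_le hb0] at hσ
          simp [ih σ hσ.1 (hσ.2.trans (hcase.le.trans hst)) hσ.2]
      have hsplit := intervalIntegral.integral_add_adjacent_intervals
        (intervalIntegrable_sub_rpow_mul hα hf le_rfl hb0 p)
        (intervalIntegrable_sub_rpow_mul hα hf hb0 hp0 p)
      have hbound : ∀ σ ∈ Icc b p, |a σ * x σ| ≤ |a m| * |x p| := by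
        intro σ hσ
        rw [abs_mul]
        exact mul_le_mul (hm ⟨hb0.trans hσ.1, hσ.2.trans (hp2.trans hst)⟩)
          (hp ⟨hσ.1, hσ.2.trans hp2⟩) (abs_nonneg _) (abs_nonneg _)
      have h1 := integral_sub_rpow_mul_le hα hf hb0 hp1
        fun σ hσ => (le_abs_self _).trans (hbound σ hσ)
      have h2 := integral_sub_rpow_mul_le hα (f := fun s => -(a s * x s)) hf.neg hb0 hp1
        fun σ hσ => (neg_le_abs _).trans (hbound σ hσ)
      simp only [mul_neg, intervalIntegral.integral_neg] at h2
      have h3 := heq p hp0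
      have h4 := hsmall (p - b) (by linarith) (by linarith)
      have h5 : g * |x p| ≤ |a m| * |x p| * ((p - b) ^ α / α) := by
        rw [← abs_of_pos hg, ← abs_mul]
        exact abs_le'.2 ⟨by linarith, by linarith⟩
      have h6 : |x p| = 0 := by
        by_contra hne
        have : 0 < |x p| := lt_of_le_of_ne (abs_nonneg _) (Ne.symm hne)
        nlinarith
      have h7 : |x s| ≤ |x p| := hp ⟨hcase.le, le_rfl⟩
      exact abs_eq_zero.1 (le_antisymm (h7.trans h6.le) (abs_nonneg _))
  obtain ⟨n, hn⟩ := exists_nat_ge (t / (d / 2))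
  exact key n t ht le_rfl ((div_le_iff₀ (by linarith)).1 hn)

/-- The Abel kernel on the triangle `0 < σ < s ≤ T`. -/
noncomputable def abelKernel (α s σ : ℝ) : ℝ := if σ < s then (s - σ) ^ (α - 1) else 0

theorem measurable_abelKernel (α : ℝ) : Measurable (Function.uncurry (abelKernel α)) := by
  unfold abelKernel Function.uncurry
  refine Measurable.ite (measurableSet_lt measurable_snd measurable_fst) ?_ measurable_const
  exact (measurable_fst.sub measurable_snd).pow_const _

theorem integral_abelKernel_mul (α s T : ℝ) (hs : s ≤ T) (f : ℝ → ℝ) :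
    ∫ σ in Ioc 0 T, abelKernel α s σ * f σ = ∫ σ in Ioc 0 s, (s - σ) ^ (α - 1) * f σ := by
  rw [integral_Ioc_eq_integral_Ioo (y := s), ← MeasureTheory.integral_indicator measurableSet_Ioc,
    ← MeasureTheory.integral_indicator measurableSet_Ioo]
  congr 1
  ext σ
  by_cases h : σ < s
  · by_cases h0 : 0 < σ
    · rw [indicator_of_mem (s := Ioc 0 T) ⟨h0, h.le.trans hs⟩,
        indicator_of_mem (s := Ioo 0 s) ⟨h0, h⟩, abelKernel, if_pos h]
    · rw [indicator_of_notMem (fun H => h0 H.1), indicator_of_notMem (fun H => h0 H.1)]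
  · rw [indicator_of_notMem (s := Ioo 0 s) (fun H => h H.2)]
    simp [indicator, abelKernel, h]

theorem integral_mul_abelKernel (α σ T : ℝ) (hσ : 0 ≤ σ) (f : ℝ → ℝ) :
    ∫ s in Ioc 0 T, f s * abelKernel α s σ = ∫ s in Ioc σ T, f s * (s - σ) ^ (α - 1) := by
  rw [← MeasureTheory.integral_indicator measurableSet_Ioc,
    ← MeasureTheory.integral_indicator measurableSet_Ioc]
  congr 1
  ext s
  by_cases h : σ < s
  · by_cases h0 : s ≤ T
    · rw [indicator_of_mem (s := Ioc 0 T) ⟨hσ.trans_lt h, h0⟩,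
        indicator_of_mem (s := Ioc σ T) ⟨h, h0⟩, abelKernel, if_pos h]
    · rw [indicator_of_notMem (fun H => h0 H.2), indicator_of_notMem (fun H => h0 H.2)]
  · rw [indicator_of_notMem (s := Ioc σ T) (fun H => h H.1)]
    simp [indicator, abelKernel, h]

theorem integrable_abelKernel {α : ℝ} (hα : 0 < α) (T : ℝ) :
    Integrable (Function.uncurry (abelKernel α))
      ((volume.restrict (Ioc 0 T)).prod (volume.restrict (Ioc 0 T))) := by
  rw [integrable_prod_iff (measurable_abelKernel α).aestronglyMeasurable]
  constructor
  · refine (ae_restrict_mem measurableSet_Ioc).mono fun s hs => ?_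
    have h := (intervalIntegrable_iff_integrableOn_Ioc_of_le hs.1.le).1
      (intervalIntegrable_sub_rpow hα 0 s s)
    have h2 : Integrable ((Iio s).indicator fun σ => (s - σ) ^ (α - 1))
        (volume.restrict (Ioc 0 T)) := by
      rw [integrable_indicator_iff measurableSet_Iio, IntegrableOn,
        Measure.restrict_restrict measurableSet_Iio]
      exact h.mono_set fun σ hσ => ⟨hσ.2.1, le_of_lt hσ.1⟩
    exact h2
  · have h : IntegrableOn (fun s : ℝ => s ^ α / α) (Ioc 0 T) := by
      refine (ContinuousOn.integrableOn_Icc ?_).mono_set Ioc_subset_Icc_self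
      exact ((Real.continuous_rpow_const hα.le).div_const α).continuousOn
    refine h.congr ((ae_restrict_mem measurableSet_Ioc).mono fun s hs => ?_)
    have hnorm : ∀ σ, ‖abelKernel α s σ‖ = abelKernel α s σ * 1 := by
      intro σ
      rw [mul_one, Real.norm_of_nonneg]
      unfold abelKernel
      split_ifs with h
      · exact Real.rpow_nonneg (by linarith) _
      · exact le_rfl
    simp only [Function.uncurry, hnorm]
    rw [integral_abelKernel_mul α s T hs.2, ← intervalIntegral.integral_of_le hs.1.le]
    simp [integral_sub_rpow hα]

/-- Dirichlet's formula for the Abel kernel. -/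
theorem integral_mul_abel_swap {α : ℝ} (hα : 0 < α) {T : ℝ} (hT : 0 ≤ T) {p u : ℝ → ℝ}
    (hp : ContinuousOn p (Icc 0 T)) (hu : ContinuousOn u (Icc 0 T)) :
    ∫ s in (0:ℝ)..T, p s * ∫ σ in (0:ℝ)..s, (s - σ) ^ (α - 1) * u σ =
      ∫ σ in (0:ℝ)..T, (∫ s in σ..T, p s * (s - σ) ^ (α - 1)) * u σ := by
  set μ := volume.restrict (Ioc (0:ℝ) T) with hμ
  have hmp : AEStronglyMeasurable p μ :=
    (hp.mono Ioc_subset_Icc_self).aestronglyMeasurable measurableSet_Ioc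
  have hmu : AEStronglyMeasurable u μ :=
    (hu.mono Ioc_subset_Icc_self).aestronglyMeasurable measurableSet_Ioc
  obtain ⟨P, hP⟩ := isCompact_Icc.exists_bound_of_continuousOn hp
  obtain ⟨U, hU⟩ := isCompact_Icc.exists_bound_of_continuousOn hu
  have hbox : ∀ᵐ z : ℝ × ℝ ∂(μ.prod μ), z ∈ Ioc 0 T ×ˢ Ioc 0 T := by
    rw [hμ, Measure.prod_restrict]
    exact ae_restrict_mem (measurableSet_Ioc.prod measurableSet_Ioc)
  have hI : Integrable (Function.uncurry fun s σ => p s * (abelKernel α s σ * u σ))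
      (μ.prod μ) := by
    refine Integrable.bdd_mul (c := P) ?_ hmp.comp_fst
      (hbox.mono fun z hz => hP _ (Ioc_subset_Icc_self hz.1))
    exact Integrable.mul_bdd (c := U) (integrable_abelKernel hα T) hmu.comp_snd
      (hbox.mono fun z hz => hU _ (Ioc_subset_Icc_self hz.2))
  have hswap := integral_integral_swap hI
  rw [intervalIntegral.integral_of_le hT, intervalIntegral.integral_of_le hT]
  refine Eq.trans ?_ (hswap.trans ?_)
  · refine setIntegral_congr_fun measurableSet_Ioc fun s hs => ?_
    rw [MeasureTheory.integral_const_mul, integral_abelKernel_mul α s T hs.2,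
      intervalIntegral.integral_of_le hs.1.le]
  · refine setIntegral_congr_fun measurableSet_Ioc fun σ hσ => ?_
    simp only [← mul_assoc]
    rw [MeasureTheory.integral_mul_const, integral_mul_abelKernel α σ T hσ.1.le,
      intervalIntegral.integral_of_le hσ.2]

/-- A probability density on the half line with tail `(τ / (v + τ)) ^ α`. -/
noncomputable def paretoDensity (α τ v : ℝ) : ℝ := α * τ ^ α * (v + τ) ^ (-α - 1)

theorem continuousOn_paretoDensity_sub {α τ : ℝ} (hτ : 0 < τ) (T : ℝ) :
    ContinuousOn (fun s => paretoDensity α τ (T - s)) (Iic T) := by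
  unfold paretoDensity
  refine ContinuousOn.mul continuousOn_const (ContinuousOn.rpow_const (by fun_prop) ?_)
  intro s hs
  left
  have : s ≤ T := hs
  linarith

theorem integral_paretoDensity_sub {α τ T : ℝ} (hτ : 0 < τ) (hT : 0 ≤ T) :
    ∫ s in (0:ℝ)..T, paretoDensity α τ (T - s) = 1 - τ ^ α * (T + τ) ^ (-α) := by
  have h : ∀ s ∈ uIcc 0 T, HasDerivAt (fun s => τ ^ α * (T - s + τ) ^ (-α))
      (paretoDensity α τ (T - s)) s := by
    intro s hs
    rw [uIcc_of_le hT] at hs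
    have h1 : HasDerivAt (fun s => T - s + τ) (-1) s := by
      simpa using ((hasDerivAt_id s).const_sub T).add_const τ
    have h2 := (h1.rpow_const (p := -α) (Or.inl (by linarith [hs.2]))).const_mul (τ ^ α)
    refine h2.congr_deriv ?_
    unfold paretoDensity
    ring
  rw [intervalIntegral.integral_eq_sub_of_hasDerivAt h]
  · simp [← Real.rpow_add hτ]
  · refine ((continuousOn_paretoDensity_sub hτ T).mono ?_).intervalIntegrable
    rw [uIcc_of_le hT]
    exact fun s hs => hs.2

theorem integral_paretoDensity_mul_abel {α τ σ T : ℝ} (hα : 0 < α) (hτ : 0 < τ) (hσ : σ < T) :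
    ∫ s in σ..T, paretoDensity α τ (T - s) * (s - σ) ^ (α - 1) =
      (T - σ) ^ α / (T - σ + τ) := by
  have hq : 0 < T - σ + τ := by linarith
  have h : ∀ s ∈ Ioo σ T, HasDerivAt
      (fun s => τ ^ α / (T - σ + τ) * ((s - σ) ^ α * (T - s + τ) ^ (-α)))
      (paretoDensity α τ (T - s) * (s - σ) ^ (α - 1)) s := by
    intro s hs
    have hA : 0 < s - σ := by linarith [hs.1]
    have hB : 0 < T - s + τ := by linarith [hs.2]
    have h0 : HasDerivAt (fun s => s - σ) 1 s := (hasDerivAt_id s).sub_const σ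
    have h1 : HasDerivAt (fun s => T - s + τ) (-1) s := by
      simpa using ((hasDerivAt_id s).const_sub T).add_const τ
    have h2 := ((h0.rpow_const (p := α) (Or.inl hA.ne')).mul
      (h1.rpow_const (p := -α) (Or.inl hB.ne'))).const_mul (τ ^ α / (T - σ + τ))
    refine h2.congr_deriv ?_
    have e1 : (s - σ) ^ α = (s - σ) ^ (α - 1) * (s - σ) := by
      rw [← Real.rpow_add_one hA.ne']; simp
    have e2 : (T - s + τ) ^ (-α) = (T - s + τ) ^ (-α - 1) * (T - s + τ) := by
      rw [← Real.rpow_add_one hB.ne']; simp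
    rw [e1, e2]
    unfold paretoDensity
    field_simp
    ring
  rw [intervalIntegral.integral_eq_sub_of_hasDerivAt_of_le hσ.le _ h]
  · have e : τ ^ α * τ ^ (-α) = 1 := by rw [← Real.rpow_add hτ]; simp
    simp only [sub_self, Real.zero_rpow hα.ne', zero_mul, mul_zero, sub_zero, zero_add]
    rw [div_mul_eq_mul_div, mul_left_comm, e, mul_one]
  · have hi := (intervalIntegral.intervalIntegrable_rpow' (a := σ - σ) (b := T - σ)
      (r := α - 1) (by linarith)).comp_sub_right σ
    simp only [sub_add_cancel] at hi
    refine hi.continuousOn_mul ((continuousOn_paretoDensity_sub hτ T).mono ?_)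
    rw [uIcc_of_le hσ.le]
    exact fun s hs => hs.2
  · refine ContinuousOn.mul continuousOn_const (ContinuousOn.mul ?_ ?_)
    · exact ((Real.continuous_rpow_const hα.le).comp
        (continuous_id.sub continuous_const)).continuousOn
    · exact ContinuousOn.rpow_const (by fun_prop) fun s hs => Or.inl (by linarith [hs.2])

theorem paretoDensity_le {α τ v : ℝ} (hα : 0 < α) (hα1 : α ≤ 1) (hτ : 0 < τ) (hv : 0 < v) :
    paretoDensity α τ v ≤ α * τ ^ (-α) * v ^ (α - 1) := by
  have hq : 0 < v + τ := by linarith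
  have e1 : (v + τ) ^ (-α - 1) = (v + τ) ^ (-α - α) * (v + τ) ^ (α - 1) := by
    rw [← Real.rpow_add hq]; ring_nf
  have e2 : τ ^ (-α) = τ ^ α * τ ^ (-α - α) := by
    rw [← Real.rpow_add hτ]; ring_nf
  have h1 : (v + τ) ^ (-α - α) ≤ τ ^ (-α - α) :=
    Real.rpow_le_rpow_of_nonpos hτ (by linarith) (by linarith)
  have h2 : (v + τ) ^ (α - 1) ≤ v ^ (α - 1) :=
    Real.rpow_le_rpow_of_nonpos hv (by linarith) (by linarith)
  unfold paretoDensity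
  rw [e1, e2]
  calc α * τ ^ α * ((v + τ) ^ (-α - α) * (v + τ) ^ (α - 1))
      ≤ α * τ ^ α * (τ ^ (-α - α) * v ^ (α - 1)) := by gcongr
    _ = _ := by ring

/-- Subtracting a multiple of the Pareto average from the Volterra equation bounds positive
solutions. -/
theorem volterra_le {α : ℝ} (hα : 0 < α) (hα1 : α ≤ 1) {u x : ℝ → ℝ} {g x₀ c δ τ T : ℝ}
    (hg : 0 < g) (hc : 0 < c) (hδ1 : δ ≤ 1) (hτ : 0 < τ)
    (hτδ : g * (α * τ ^ (-α)) ≤ c * δ)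
    (hu : ContinuousOn u (Ici 0)) (hx : ContinuousOn x (Ici 0))
    (hx0 : ∀ t, 0 ≤ t → 0 ≤ x t) (hux : ∀ t, 0 ≤ t → c * x t ≤ u t)
    (heq : ∀ t, 0 ≤ t → g * x t = g * x₀ - ∫ s in (0:ℝ)..t, (t - s) ^ (α - 1) * u s)
    (hT : 0 ≤ T) : x T ≤ x₀ * (1 - (1 - δ) * (1 - τ ^ α * (T + τ) ^ (-α))) := by
  set p : ℝ → ℝ := fun s => paretoDensity α τ (T - s) with hp
  have hpc : ContinuousOn p (Icc 0 T) :=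
    (continuousOn_paretoDensity_sub hτ T).mono fun s hs => hs.2
  have hp0 : ∀ s ≤ T, 0 ≤ p s := fun s hs => by
    have : 0 < T - s + τ := by linarith
    simp only [hp, paretoDensity]
    positivity
  have hxT : ContinuousOn x (Icc 0 T) := hx.mono fun s hs => hs.1
  have huT : ContinuousOn u (Icc 0 T) := hu.mono fun s hs => hs.1
  have hpi : IntervalIntegrable p volume 0 T := by
    apply ContinuousOn.intervalIntegrable; rwa [uIcc_of_le hT]
  have hpxi : IntervalIntegrable (fun s => p s * x s) volume 0 T := by
    apply ContinuousOn.intervalIntegrable; rw [uIcc_of_le hT]; exact hpc.mul hxT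
  have hδ0 : 0 ≤ δ := by
    by_contra! h
    have : 0 < g * (α * τ ^ (-α)) := by positivity
    nlinarith
  have hswap := integral_mul_abel_swap hα hT hpc huT
  have hleft : ∫ s in (0:ℝ)..T, p s * ∫ σ in (0:ℝ)..s, (s - σ) ^ (α - 1) * u σ =
      g * x₀ * (∫ s in (0:ℝ)..T, p s) - g * ∫ s in (0:ℝ)..T, p s * x s := by
    rw [← intervalIntegral.integral_const_mul, ← intervalIntegral.integral_const_mul,
      ← intervalIntegral.integral_sub (hpi.const_mul _) (hpxi.const_mul _)]
    refine intervalIntegral.integral_congr fun s hs => ?_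
    rw [uIcc_of_le hT] at hs
    have := heq s hs.1
    rw [show ∫ σ in (0:ℝ)..s, (s - σ) ^ (α - 1) * u σ = g * x₀ - g * x s by linarith]
    ring
  have hright : ∫ σ in (0:ℝ)..T, (∫ s in σ..T, p s * (s - σ) ^ (α - 1)) * u σ =
      ∫ σ in (0:ℝ)..T, (T - σ) ^ α / (T - σ + τ) * u σ := by
    rw [intervalIntegral.integral_of_le hT, intervalIntegral.integral_of_le hT,
      integral_Ioc_eq_integral_Ioo, integral_Ioc_eq_integral_Ioo]
    refine setIntegral_congr_fun measurableSet_Ioo fun σ hσ => ?_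
    simp only [hp]
    rw [integral_paretoDensity_mul_abel hα hτ hσ.2]
  have hqi : IntervalIntegrable (fun σ => (T - σ) ^ α / (T - σ + τ) * u σ) volume 0 T := by
    apply ContinuousOn.intervalIntegrable
    rw [uIcc_of_le hT]
    refine ContinuousOn.mul (ContinuousOn.div ?_ (by fun_prop) ?_) huT
    · exact ((Real.continuous_rpow_const hα.le).comp
        (continuous_const.sub continuous_id)).continuousOn
    · intro s hs
      have := hs.2
      exact (by linarith : 0 < T - s + τ).ne'
  have hmono : ∫ σ in (0:ℝ)..T, ((1 - δ) * ((T - σ) ^ α / (T - σ + τ) * u σ)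
        + (1 - δ) * g * (p σ * x σ)) ≤ ∫ σ in (0:ℝ)..T, (T - σ) ^ (α - 1) * u σ := by
    refine intervalIntegral.integral_mono_on_of_le_Ioo hT
      ((hqi.const_mul _).add (hpxi.const_mul _))
      (intervalIntegrable_sub_rpow_mul hα hu le_rfl hT T) fun σ hσ => ?_
    have hv : 0 < T - σ := by linarith [hσ.2]
    have hk : 0 ≤ (T - σ) ^ (α - 1) := Real.rpow_nonneg hv.le _
    have hxσ := hx0 σ hσ.1.le
    have huσ := hux σ hσ.1.le
    have hu0 : 0 ≤ u σ := (mul_nonneg hc.le hxσ).trans huσ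
    have h1 : (T - σ) ^ α / (T - σ + τ) ≤ (T - σ) ^ (α - 1) := by
      rw [div_le_iff₀ (by linarith), mul_add, ← Real.rpow_add_one hv.ne', sub_add_cancel]
      nlinarith
    have h2 : (T - σ) ^ α / (T - σ + τ) * u σ ≤ (T - σ) ^ (α - 1) * u σ :=
      mul_le_mul_of_nonneg_right h1 hu0
    have h3 : g * (p σ * x σ) ≤ δ * ((T - σ) ^ (α - 1) * u σ) :=
      calc g * (p σ * x σ) ≤ g * (α * τ ^ (-α) * (T - σ) ^ (α - 1) * x σ) := by
            have := paretoDensity_le hα hα1 hτ hv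
            simp only [hp]
            gcongr
        _ = g * (α * τ ^ (-α)) * ((T - σ) ^ (α - 1) * x σ) := by ring
        _ ≤ c * δ * ((T - σ) ^ (α - 1) * x σ) := by gcongr
        _ = δ * ((T - σ) ^ (α - 1) * (c * x σ)) := by ring
        _ ≤ _ := by gcongr
    have h4 : 0 ≤ g * (p σ * x σ) := by
      have := hp0 σ hσ.2.le
      positivity
    nlinarith
  rw [intervalIntegral.integral_add (hqi.const_mul _) (hpxi.const_mul _),
    intervalIntegral.integral_const_mul, intervalIntegral.integral_const_mul,
    ← hright, ← hswap, hleft, hp, integral_paretoDensity_sub hτ hT] at hmono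
  have := heq T hT
  refine le_of_mul_le_mul_left ?_ hg
  linarith

theorem tendsto_zero_of_volterra_of_nonneg {α : ℝ} (hα : 0 < α) (hα1 : α ≤ 1) {u x : ℝ → ℝ}
    {g x₀ c : ℝ} (hg : 0 < g) (hx₀ : 0 ≤ x₀) (hc : 0 < c)
    (hu : ContinuousOn u (Ici 0)) (hx : ContinuousOn x (Ici 0))
    (hx0 : ∀ t, 0 ≤ t → 0 ≤ x t) (hux : ∀ t, 0 ≤ t → c * x t ≤ u t)
    (heq : ∀ t, 0 ≤ t → g * x t = g * x₀ - ∫ s in (0:ℝ)..t, (t - s) ^ (α - 1) * u s) :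
    Tendsto x atTop (𝓝 0) := by
  rw [tendsto_order]
  refine ⟨fun b hb => (eventually_ge_atTop 0).mono fun t ht => hb.trans_le (hx0 t ht),
    fun ε hε => ?_⟩
  set δ : ℝ := min 1 (ε / (2 * (x₀ + 1))) with hδ
  have hδpos : 0 < δ := lt_min one_pos (by positivity)
  have hδ1 : δ ≤ 1 := min_le_left _ _
  have hδε : x₀ * δ < ε := by
    have : δ * (2 * (x₀ + 1)) ≤ ε := (le_div_iff₀ (by positivity)).1 (min_le_right _ _)
    nlinarith
  have hlim : Tendsto (fun τ : ℝ => g * (α * τ ^ (-α))) atTop (𝓝 0) := by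
    simpa using ((tendsto_rpow_neg_atTop hα).const_mul α).const_mul g
  obtain ⟨τ, hτδ, hτ⟩ := ((hlim.eventually (gt_mem_nhds (mul_pos hc hδpos))).and
    (eventually_gt_atTop 0)).exists
  have hlim2 : Tendsto
      (fun T : ℝ => x₀ * (1 - (1 - δ) * (1 - τ ^ α * (T + τ) ^ (-α)))) atTop
      (𝓝 (x₀ * (1 - (1 - δ) * (1 - τ ^ α * 0)))) :=
    (((((tendsto_rpow_neg_atTop hα).comp (tendsto_atTop_add_const_right _ τ tendsto_id)).const_mul
      (τ ^ α)).const_sub 1).const_mul (1 - δ)).const_sub 1 |>.const_mul x₀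
  have hlt : x₀ * (1 - (1 - δ) * (1 - τ ^ α * 0)) < ε := by linarith
  filter_upwards [hlim2.eventually (gt_mem_nhds hlt), eventually_ge_atTop 0] with T hT hT0
  exact (volterra_le hα hα1 hg hc hδ1 hτ hτδ.le hu hx hx0 hux heq hT0).trans_lt hT

theorem tendsto_zero_of_volterra_of_pos {α : ℝ} (hα : 0 < α) (hα1 : α ≤ 1) {a x : ℝ → ℝ}
    {g x₀ c : ℝ} (hg : 0 < g) (hx₀ : 0 < x₀) (hc : 0 < c)
    (ha : ContinuousOn a (Ici 0)) (hac : ∀ t, 0 ≤ t → a t ≤ -c) (hx : ContinuousOn x (Ici 0))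
    (heq : ∀ t, 0 ≤ t → g * x t = g * x₀ + ∫ s in (0:ℝ)..t, (t - s) ^ (α - 1) * (a s * x s)) :
    Tendsto x atTop (𝓝 0) := by
  have hpos : ∀ t, 0 ≤ t → 0 ≤ x t := fun t ht =>
    (volterra_pos hα hα1 hg hx₀ ha (fun s hs => (hac s hs).trans (by linarith)) hx heq ht).le
  refine tendsto_zero_of_volterra_of_nonneg hα hα1 hg hx₀.le hc (u := fun s => -(a s * x s))
    (ha.mul hx).neg hx hpos (fun t ht => ?_) fun t ht => ?_
  · nlinarith [hac t ht, hpos t ht]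
  · simp only [mul_neg, intervalIntegral.integral_neg, sub_neg_eq_add]
    exact heq t ht

/-- Asymptotic stability of the linear equation `^C D^α_{0+} x(t) = a(t)·x(t)` when
`sup_{t ≥ 0} a(t) < 0`: every solution tends to `0` at infinity. -/
theorem caputo_linear_asymptotic_stability (α : ℝ) (hα : 0 < α) (hα1 : α ≤ 1)
    (a : ℝ → ℝ) (ha : ContinuousOn a (Set.Ici 0))
    (hsup : sSup (a '' Set.Ici 0) < 0) :
    ∀ (x₀ : ℝ) (x : ℝ → ℝ), IsCaputoSolutionIci α (fun t y => a t * y) x₀ x →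
      Filter.Tendsto x Filter.atTop (nhds 0) := by
  intro x₀ x ⟨hx, heq⟩
  have hg := Real.Gamma_pos_of_pos hα
  have hbdd : BddAbove (a '' Set.Ici 0) := by
    by_contra h
    rw [Real.sSup_of_not_bddAbove h] at hsup
    exact lt_irrefl _ hsup
  have hac : ∀ t, 0 ≤ t → a t ≤ -(-sSup (a '' Set.Ici 0)) := fun t ht => by
    rw [neg_neg]
    exact le_csSup hbdd ⟨t, ht, rfl⟩
  have hc : 0 < -sSup (a '' Set.Ici 0) := by linarith
  have heq' : ∀ t, 0 ≤ t → Real.Gamma α * x t = Real.Gamma α * x₀ +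
      ∫ s in (0:ℝ)..t, (t - s) ^ (α - 1) * (a s * x s) := fun t ht => by
    rw [heq t ht]
    field_simp
  rcases lt_trichotomy x₀ 0 with h | h | h
  · have := tendsto_zero_of_volterra_of_pos hα hα1 (x := fun t => -x t) hg (neg_pos.2 h) hc ha hac
      hx.neg fun t ht => by
        simp only [mul_neg, intervalIntegral.integral_neg]
        linarith [heq' t ht]
    simpa using this.neg
  · refine tendsto_const_nhds.congr' ((eventually_ge_atTop 0).mono fun t ht => ?_)
    exact (volterra_eq_zero hα hg ha hx (fun s hs => by simpa [h] using heq' s hs) ht).symm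
  · exact tendsto_zero_of_volterra_of_pos hα hα1 hg h hc ha hac hx heq'
end

section
/- Let α ∈ (0,1], T > 0, and let f : [0,T] × ℝ → ℝ be continuous, satisfy the Lipschitz condition, and satisfy f(t,0) = 0 for all t ∈ [0,T]. Let x₀ > 0 and let φ(·, x₀) be the solution on [0,T] of the Caputo fractional initial value problem with initial value x₀. Then for all t ∈ [0,T]: x₀ · E_α(a_*(t) t^α) ≤ φ(t, x₀) ≤ x₀ · E_α(a^*(t) t^α), where a_*(t) := inf_{s ∈ [0,t], x ≠ 0} f(s,x)/x and a^*(t) := sup_{s ∈ [0,t], x ≠ 0} f(s,x)/x. -/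
open Set intervalIntegral

/-- `a_*(t) = inf_{s ∈ [0,t], x ≠ 0} f(s,x)/x`. -/
noncomputable def aLow (f : ℝ → ℝ → ℝ) (t : ℝ) : ℝ :=
  sInf {y | ∃ s ∈ Set.Icc 0 t, ∃ x : ℝ, x ≠ 0 ∧ y = f s x / x}

/-- `a^*(t) = sup_{s ∈ [0,t], x ≠ 0} f(s,x)/x`. -/
noncomputable def aHigh (f : ℝ → ℝ → ℝ) (t : ℝ) : ℝ :=
  sSup {y | ∃ s ∈ Set.Icc 0 t, ∃ x : ℝ, x ≠ 0 ∧ y = f s x / x}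

theorem integral_sub_rpow_mul_rpow {p q t : ℝ} (hp : 0 < p) (hq : 0 < q) (ht : 0 < t) :
    ∫ s in (0 : ℝ)..t, (t - s) ^ (p - 1) * s ^ (q - 1) =
      t ^ (p + q - 1) * (Real.Gamma p * Real.Gamma q / Real.Gamma (p + q)) := by
  have h := Complex.betaIntegral_scaled (q : ℂ) (p : ℂ) ht
  rw [Complex.betaIntegral_eq_Gamma_mul_div _ _ (by simpa using hq) (by simpa using hp)] at h
  have hint : (∫ x in (0 : ℝ)..t, (x : ℂ) ^ ((q : ℂ) - 1) * ((t : ℂ) - x) ^ ((p : ℂ) - 1)) =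
      ((∫ s in (0 : ℝ)..t, (t - s) ^ (p - 1) * s ^ (q - 1) : ℝ) : ℂ) := by
    rw [← intervalIntegral.integral_ofReal]
    refine intervalIntegral.integral_congr fun s hs => ?_
    rw [uIcc_of_le ht.le] at hs
    push_cast
    rw [Complex.ofReal_cpow (sub_nonneg.2 hs.2), Complex.ofReal_cpow hs.1]
    push_cast
    ring
  rw [hint] at h
  apply Complex.ofReal_injective
  rw [h]
  push_cast
  rw [Complex.ofReal_cpow ht.le]
  simp only [← Complex.Gamma_ofReal]
  push_cast
  rw [add_comm (q : ℂ) p, mul_comm (Complex.Gamma q)]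

theorem rpow_mul_exp_neg_le_Gamma {M x : ℝ} (hM : 0 < M) (hx : 0 ≤ x) :
    M ^ x * Real.exp (-M) ≤ Real.Gamma (x + 1) := by
  have hGi := Real.GammaIntegral_convergent (by linarith : 0 < x + 1)
  rw [Real.Gamma_eq_integral (by linarith), ← integral_exp_neg_Ioi M,
    ← MeasureTheory.integral_const_mul]
  calc ∫ y in Ioi M, M ^ x * Real.exp (-y)
      ≤ ∫ y in Ioi M, Real.exp (-y) * y ^ (x + 1 - 1) := by
        refine MeasureTheory.setIntegral_mono_on ?_ (hGi.mono_set (Ioi_subset_Ioi hM.le))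
          measurableSet_Ioi fun y hy => ?_
        · exact (integrableOn_exp_neg_Ioi M).const_mul _
        · rw [mul_comm, add_sub_cancel_right]
          gcongr
          exact le_of_lt hy
    _ ≤ ∫ y in Ioi 0, Real.exp (-y) * y ^ (x + 1 - 1) := by
        refine MeasureTheory.setIntegral_mono_set hGi ?_ (Ioi_subset_Ioi hM.le).eventuallyLE
        filter_upwards [MeasureTheory.ae_restrict_mem measurableSet_Ioi] with y hy
        have : (0 : ℝ) < y := hy
        positivity

theorem Gamma_mul_natCast_add_one_pos {α : ℝ} (hα : 0 < α) (k : ℕ) :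
    0 < Real.Gamma (α * (k : ℝ) + 1) :=
  Real.Gamma_pos_of_pos (by positivity)

theorem summable_mittagLeffler {α : ℝ} (hα : 0 < α) (x : ℝ) :
    Summable fun k : ℕ => x ^ k / Real.Gamma (α * (k : ℝ) + 1) := by
  set A : ℝ := 2 * |x| + 1 with hA
  have hA0 : 0 < A := by positivity
  set M : ℝ := A ^ α⁻¹ with hM
  have hM0 : 0 < M := by positivity
  have hMα : M ^ α = A := by
    rw [hM, ← Real.rpow_mul hA0.le, inv_mul_cancel₀ hα.ne', Real.rpow_one]
  have hr : |x| / A < 1 := by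
    rw [div_lt_one hA0, hA]
    linarith [abs_nonneg x]
  refine Summable.of_norm_bounded
    ((summable_geometric_of_lt_one (by positivity) hr).mul_left (Real.exp M)) fun k => ?_
  have hΓ := Gamma_mul_natCast_add_one_pos hα k
  have h := rpow_mul_exp_neg_le_Gamma hM0 (by positivity : 0 ≤ α * (k : ℝ))
  rw [Real.rpow_mul hM0.le, hMα, Real.rpow_natCast, Real.exp_neg, ← div_eq_mul_inv,
    div_le_iff₀ (Real.exp_pos M)] at h
  rw [norm_div, norm_pow, Real.norm_eq_abs, Real.norm_of_nonneg hΓ.le, div_pow, ← mul_div_assoc,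
    div_le_div_iff₀ hΓ (by positivity)]
  calc |x| ^ k * A ^ k
      ≤ |x| ^ k * (Real.Gamma (α * (k : ℝ) + 1) * Real.exp M) := by gcongr
    _ = Real.exp M * |x| ^ k * Real.Gamma (α * (k : ℝ) + 1) := by ring

theorem continuous_mittagLeffler {α : ℝ} (hα : 0 < α) : Continuous (mittagLeffler α) := by
  rw [continuous_iff_continuousAt]
  intro x
  have hc : ContinuousOn (mittagLeffler α) (Metric.closedBall 0 (|x| + 1)) := by
    refine continuousOn_tsum (fun k => by fun_prop) (summable_mittagLeffler hα (|x| + 1))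
      fun k y hy => ?_
    have hΓ := Gamma_mul_natCast_add_one_pos hα k
    rw [norm_div, norm_pow, Real.norm_of_nonneg hΓ.le]
    gcongr
    simpa using hy
  exact hc.continuousAt (Metric.closedBall_mem_nhds_of_mem (by simp))

theorem mittagLeffler_zero (α : ℝ) : mittagLeffler α 0 = 1 := by
  rw [mittagLeffler, tsum_eq_single 0 fun k hk => by simp [hk]]
  simp

theorem mittagLeffler_pos {α x : ℝ} (hα : 0 < α) (hx : 0 ≤ x) : 0 < mittagLeffler α x := by
  refine (summable_mittagLeffler hα x).tsum_pos (fun k => ?_) 0 (by simp)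
  have hΓ := Gamma_mul_natCast_add_one_pos hα k
  positivity

theorem intervalIntegrable_sub_rpow_mul_s11 {α a t : ℝ} (hα : 0 < α) {g : ℝ → ℝ}
    (hat : a ≤ t) (hg : ContinuousOn g (Icc a t)) :
    IntervalIntegrable (fun s => (t - s) ^ (α - 1) * g s) MeasureTheory.volume a t := by
  refine IntervalIntegrable.mul_continuousOn ?_ (by rwa [uIcc_of_le hat])
  have h := (intervalIntegrable_rpow' (a := t - a) (b := 0)
    (by linarith : -1 < α - 1)).comp_sub_left t
  simpa using h

theorem continuousOn_mittagLeffler_rpow {α : ℝ} (hα : 0 < α) (c t : ℝ) :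
    ContinuousOn (fun s : ℝ => mittagLeffler α (c * s ^ α)) (Icc 0 t) :=
  ((continuous_mittagLeffler hα).comp
    (continuous_const.mul (Real.continuous_rpow_const hα.le))).continuousOn

/-- The function `E_α(c t^α)` solves the linear Volterra equation `u = 1 + I^α (c u)`. -/
theorem mittagLeffler_rpow_eq {α : ℝ} (hα : 0 < α) (c : ℝ) {t : ℝ} (ht : 0 ≤ t) :
    mittagLeffler α (c * t ^ α) = 1 + (1 / Real.Gamma α) *
      ∫ s in (0 : ℝ)..t, (t - s) ^ (α - 1) * (c * mittagLeffler α (c * s ^ α)) := by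
  rcases ht.eq_or_lt with rfl | ht
  · simp [Real.zero_rpow hα.ne', mittagLeffler_zero]
  have hΓα : 0 < Real.Gamma α := Real.Gamma_pos_of_pos hα
  have hterm (k : ℕ) : ∫ s in (0 : ℝ)..t,
      (t - s) ^ (α - 1) * (c * ((c * s ^ α) ^ k / Real.Gamma (α * (k : ℝ) + 1))) =
      Real.Gamma α * ((c * t ^ α) ^ (k + 1) / Real.Gamma (α * ((k + 1 : ℕ) : ℝ) + 1)) := by
    have hΓ := Gamma_mul_natCast_add_one_pos hα k
    have hpow : ∀ s ∈ Icc 0 t, (s ^ α) ^ k = s ^ (α * (k : ℝ) + 1 - 1) := fun s hs => by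
      rw [add_sub_cancel_right, Real.rpow_mul hs.1, Real.rpow_natCast]
    calc _ = ∫ s in (0 : ℝ)..t, (c ^ (k + 1) / Real.Gamma (α * (k : ℝ) + 1)) *
          ((t - s) ^ (α - 1) * s ^ (α * (k : ℝ) + 1 - 1)) := by
          refine intervalIntegral.integral_congr fun s hs => ?_
          rw [uIcc_of_le ht.le] at hs
          rw [← hpow s hs]
          ring
      _ = _ := by
          rw [intervalIntegral.integral_const_mul,
            integral_sub_rpow_mul_rpow hα (by positivity) ht, mul_pow, ← Real.rpow_natCast (t ^ α),
            ← Real.rpow_mul ht.le]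
          have e1 : α + (α * (k : ℝ) + 1) = α * ((k + 1 : ℕ) : ℝ) + 1 := by push_cast; ring
          rw [e1, add_sub_cancel_right]
          field_simp
  have hsum : HasSum (fun k : ℕ => ∫ s in (0 : ℝ)..t,
      (t - s) ^ (α - 1) * (c * ((c * s ^ α) ^ k / Real.Gamma (α * (k : ℝ) + 1))))
      (∫ s in (0 : ℝ)..t, (t - s) ^ (α - 1) * (c * mittagLeffler α (c * s ^ α))) := by
    refine intervalIntegral.hasSum_integral_of_dominated_convergence
      (fun k s => (t - s) ^ (α - 1) *
        (|c| * ((|c| * t ^ α) ^ k / Real.Gamma (α * (k : ℝ) + 1)))) (fun k => ?_) (fun k => ?_)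
      ?_ ?_ ?_
    · exact Measurable.aestronglyMeasurable (by fun_prop)
    · refine .of_forall fun s hs => ?_
      rw [uIoc_of_le ht.le] at hs
      have hs0 : 0 ≤ t - s := sub_nonneg.2 hs.2
      have hs1 : 0 ≤ s := hs.1.le
      have hΓ := Gamma_mul_natCast_add_one_pos hα k
      rw [norm_mul, norm_mul, norm_div, norm_pow, norm_mul, Real.norm_of_nonneg hΓ.le,
        Real.norm_of_nonneg (Real.rpow_nonneg hs0 _), Real.norm_of_nonneg (Real.rpow_nonneg hs1 _),
        Real.norm_eq_abs]
      gcongr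
      exact hs.2
    · exact .of_forall fun s _ => ((summable_mittagLeffler hα _).mul_left _).mul_left _
    · simp only [tsum_mul_left]
      exact intervalIntegrable_sub_rpow_mul_s11 hα ht.le continuousOn_const
    · exact .of_forall fun s _ => ((summable_mittagLeffler hα _).hasSum.mul_left _).mul_left _
  simp_rw [hterm] at hsum
  rw [← hsum.tsum_eq, tsum_mul_left, ← mul_assoc, one_div, inv_mul_cancel₀ hΓα.ne', one_mul,
    mittagLeffler, (summable_mittagLeffler hα _).tsum_eq_zero_add]
  simp

/-- The positive kernel that recovers `∫₀^σ (t-u)^(α-1) g(u) du` from the fractional integrals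
`∫₀^s (s-u)^(α-1) g(u) du` with `s ≤ σ < t`. -/
noncomputable def balayageKernel (α σ t s : ℝ) : ℝ :=
  (σ - s) ^ (-α) * (t - σ) ^ α / (t - s) / (Real.Gamma α * Real.Gamma (1 - α))

theorem measurable_balayageKernel (α σ t : ℝ) : Measurable (balayageKernel α σ t) := by
  unfold balayageKernel
  fun_prop

theorem balayageKernel_nonneg {α σ t s : ℝ} (hα : 0 < α) (hα1 : α < 1) (hs : s ≤ σ) (hσ : σ < t) :
    0 ≤ balayageKernel α σ t s := by
  have h1 : 0 < Real.Gamma α := Real.Gamma_pos_of_pos hα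
  have h2 : 0 < Real.Gamma (1 - α) := Real.Gamma_pos_of_pos (by linarith)
  have h3 : 0 ≤ σ - s := by linarith
  have h4 : 0 ≤ t - σ := by linarith
  have h5 : 0 ≤ t - s := by linarith
  unfold balayageKernel
  positivity

theorem setIntegral_balayageKernel_mul {α σ t u : ℝ} (hα : 0 < α) (hα1 : α < 1) (hu : u < σ)
    (hσ : σ < t) :
    ∫ s in Ioc u σ, balayageKernel α σ t s * (s - u) ^ (α - 1) = (t - u) ^ (α - 1) := by
  have hΓ1 : 0 < Real.Gamma α := Real.Gamma_pos_of_pos hα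
  have hΓ2 : 0 < Real.Gamma (1 - α) := Real.Gamma_pos_of_pos (by linarith)
  have hσu : 0 < σ - u := sub_pos.2 hu
  have htσ : 0 < t - σ := sub_pos.2 hσ
  have htu : 0 < t - u := by linarith
  set y : ℝ → ℝ := fun s => (s - u) * (t - σ) / ((σ - u) * (t - s)) with hy
  set y' : ℝ → ℝ := fun s => (t - σ) * (t - u) / ((σ - u) * (t - s) ^ 2) with hy'
  have hder : ∀ s ∈ Ioo u σ, HasDerivAt y (y' s) s := fun s hs => by
    have hts : 0 < t - s := by linarith [hs.2]
    have h1 : HasDerivAt (fun s => (s - u) * (t - σ)) (1 * (t - σ)) s :=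
      ((hasDerivAt_id s).sub_const u).mul_const _
    have h2 : HasDerivAt (fun s => (σ - u) * (t - s)) ((σ - u) * -1) s :=
      ((hasDerivAt_id s).const_sub t).const_mul _
    refine (h1.div h2 (by positivity)).congr_deriv ?_
    simp only [hy']
    field_simp
    ring
  have hcont : ContinuousOn y (Icc u σ) := by
    refine ContinuousOn.div (by fun_prop) (by fun_prop) fun s hs => ?_
    have hts : 0 < t - s := by linarith [hs.2]
    positivity
  have hcv := MeasureTheory.integral_Icc_deriv_smul_of_deriv_nonneg
    (g := fun x : ℝ => (1 - x) ^ (1 - α - 1) * x ^ (α - 1)) hcont hder (fun s hs => by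
      have hts : 0 < t - s := by linarith [hs.2]
      positivity) hu.le
  have hyu : y u = 0 := by simp [hy]
  have hyσ : y σ = 1 := by
    simp only [hy]
    field_simp
  rw [hyu, hyσ, MeasureTheory.integral_Icc_eq_integral_Ioc (x := 0),
    ← intervalIntegral.integral_of_le zero_le_one,
    integral_sub_rpow_mul_rpow (by linarith) hα one_pos] at hcv
  have hB : (1 : ℝ) ^ (1 - α + α - 1) * (Real.Gamma (1 - α) * Real.Gamma α /
      Real.Gamma (1 - α + α)) = Real.Gamma α * Real.Gamma (1 - α) := by
    rw [sub_add_cancel, Real.Gamma_one, Real.one_rpow]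
    ring
  rw [hB, MeasureTheory.integral_Icc_eq_integral_Ioo] at hcv
  rw [MeasureTheory.integral_Ioc_eq_integral_Ioo]
  calc ∫ s in Ioo u σ, balayageKernel α σ t s * (s - u) ^ (α - 1)
      = ∫ s in Ioo u σ, ((t - u) ^ (α - 1) / (Real.Gamma α * Real.Gamma (1 - α))) *
          (y' s • ((1 - y s) ^ (1 - α - 1) * y s ^ (α - 1))) := by
        refine MeasureTheory.setIntegral_congr_fun measurableSet_Ioo fun s hs => ?_
        have hts : 0 < t - s := by linarith [hs.2]
        have hσs : 0 < σ - s := by linarith [hs.2]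
        have hsu : 0 < s - u := by linarith [hs.1]
        have h1y : 1 - y s = (t - u) * (σ - s) / ((σ - u) * (t - s)) := by
          simp only [hy]
          field_simp
          ring
        have e1 : 1 - α - 1 = -α := by ring
        simp only [smul_eq_mul]
        rw [h1y, e1, balayageKernel, Real.div_rpow (by positivity) (by positivity),
          Real.mul_rpow htu.le hσs.le, Real.mul_rpow hσu.le hts.le, hy, hy',
          Real.div_rpow (by positivity) (by positivity),
          Real.mul_rpow hsu.le htσ.le, Real.mul_rpow hσu.le hts.le]
        simp only [Real.rpow_sub_one htu.ne', Real.rpow_sub_one hσu.ne', Real.rpow_sub_one hts.ne',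
          Real.rpow_sub_one htσ.ne', Real.rpow_neg htu.le, Real.rpow_neg hσu.le,
          Real.rpow_neg hts.le]
        have p1 := Real.rpow_pos_of_pos htu α
        have p2 := Real.rpow_pos_of_pos hσu α
        have p3 := Real.rpow_pos_of_pos hts α
        field_simp
    _ = (t - u) ^ (α - 1) := by
        rw [MeasureTheory.integral_const_mul, hcv]
        field_simp

theorem integrableOn_balayageKernel_mul {α σ t u : ℝ} (hα : 0 < α) (hα1 : α < 1) (hu : u < σ)
    (hσ : σ < t) :
    MeasureTheory.IntegrableOn (fun s => balayageKernel α σ t s * (s - u) ^ (α - 1))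
      (Ioc u σ) := by
  by_contra h
  have h0 := setIntegral_balayageKernel_mul hα hα1 hu hσ
  rw [MeasureTheory.integral_undef h] at h0
  exact (Real.rpow_pos_of_pos (by linarith : 0 < t - u) (α - 1)).ne h0

theorem integrableOn_balayageKernel {α σ t : ℝ} (hα : 0 < α) (hα1 : α < 1) (hσ0 : 0 < σ)
    (hσ : σ < t) : MeasureTheory.IntegrableOn (balayageKernel α σ t) (Ioc 0 σ) := by
  refine MeasureTheory.Integrable.mono'
    ((integrableOn_balayageKernel_mul hα hα1 hσ0 hσ).mul_const (σ ^ (1 - α)))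
    (measurable_balayageKernel α σ t).aestronglyMeasurable ?_
  filter_upwards [MeasureTheory.ae_restrict_mem measurableSet_Ioc] with s hs
  have hH := balayageKernel_nonneg hα hα1 hs.2 hσ
  have h1 : 1 ≤ s ^ (α - 1) * σ ^ (1 - α) := by
    have h2 : σ ^ (α - 1) * σ ^ (1 - α) = 1 := by
      rw [← Real.rpow_add hσ0]
      simp
    have h3 := Real.rpow_le_rpow_of_nonpos hs.1 hs.2 (by linarith : α - 1 ≤ 0)
    exact h2.ge.trans (mul_le_mul_of_nonneg_right h3 (Real.rpow_nonneg hσ0.le _))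
  rw [Real.norm_of_nonneg hH, sub_zero, mul_assoc]
  exact le_mul_of_one_le_right hH h1

theorem setIntegral_balayageKernel_le_one {α σ t : ℝ} (hα : 0 < α) (hα1 : α < 1) (hσ0 : 0 < σ)
    (hσ : σ < t) : ∫ s in Ioc 0 σ, balayageKernel α σ t s ≤ 1 := by
  have hpos := Real.rpow_pos_of_pos hσ0 (α - 1)
  refine le_of_mul_le_mul_right ?_ hpos
  calc (∫ s in Ioc 0 σ, balayageKernel α σ t s) * σ ^ (α - 1)
      = ∫ s in Ioc 0 σ, balayageKernel α σ t s * σ ^ (α - 1) :=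
        (MeasureTheory.integral_mul_const _ _).symm
    _ ≤ ∫ s in Ioc 0 σ, balayageKernel α σ t s * (s - 0) ^ (α - 1) := by
        refine MeasureTheory.setIntegral_mono_on
          ((integrableOn_balayageKernel hα hα1 hσ0 hσ).mul_const _)
          (integrableOn_balayageKernel_mul hα hα1 hσ0 hσ) measurableSet_Ioc fun s hs => ?_
        rw [sub_zero]
        exact mul_le_mul_of_nonneg_left
          (Real.rpow_le_rpow_of_nonpos hs.1 hs.2 (by linarith))
          (balayageKernel_nonneg hα hα1 hs.2 hσ)
    _ = t ^ (α - 1) := by rw [setIntegral_balayageKernel_mul hα hα1 hσ0 hσ, sub_zero]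
    _ ≤ 1 * σ ^ (α - 1) := by
        rw [one_mul]
        exact Real.rpow_le_rpow_of_nonpos hσ0 hσ.le (by linarith)

open MeasureTheory in
theorem integrable_balayageKernel_prod {α σ t : ℝ} (hα : 0 < α) (hα1 : α < 1)
    (hσ0 : 0 < σ) (hσ : σ < t) {g : ℝ → ℝ} (hg : ContinuousOn g (Icc 0 t)) :
    Integrable (Function.uncurry fun u s : ℝ =>
      (Ioi u).indicator (fun s => balayageKernel α σ t s * (s - u) ^ (α - 1)) s * g u)
      ((volume.restrict (Ioc 0 σ)).prod (volume.restrict (Ioc 0 σ))) := by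
  have hgσ : ContinuousOn g (Icc 0 σ) := hg.mono (Icc_subset_Icc_right hσ.le)
  have hIoc : ∀ u ∈ Ioc 0 σ, Ioc 0 σ ∩ Ioi u = Ioc u σ := fun u hu => by
    rw [Ioc_inter_Ioi, sup_eq_right.2 hu.1.le]
  have hne : ∀ᵐ u ∂(volume.restrict (Ioc 0 σ)), u ∈ Ioo 0 σ := by
    rw [← restrict_Ioo_eq_restrict_Ioc]
    exact ae_restrict_mem measurableSet_Ioo
  have hmeas : AEStronglyMeasurable (Function.uncurry fun u s : ℝ =>
      (Ioi u).indicator (fun s => balayageKernel α σ t s * (s - u) ^ (α - 1)) s * g u)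
      ((volume.restrict (Ioc 0 σ)).prod (volume.restrict (Ioc 0 σ))) := by
    refine AEStronglyMeasurable.mul (Measurable.aestronglyMeasurable ?_) ?_
    · have hH := measurable_balayageKernel α σ t
      have : Measurable ({p : ℝ × ℝ | p.1 < p.2}.indicator
          fun p : ℝ × ℝ => balayageKernel α σ t p.2 * (p.2 - p.1) ^ (α - 1)) :=
        Measurable.indicator (by fun_prop) (measurableSet_lt measurable_fst measurable_snd)
      exact this
    · exact ((hgσ.mono Ioc_subset_Icc_self).aestronglyMeasurable measurableSet_Ioc).comp_fst
  rw [integrable_prod_iff hmeas]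
  refine ⟨?_, ?_⟩
  · filter_upwards [hne] with u hu
    refine Integrable.mul_const (𝕜 := ℝ) ?_ (g u)
    simp only
    rw [integrable_indicator_iff measurableSet_Ioi, IntegrableOn,
      Measure.restrict_restrict measurableSet_Ioi, inter_comm, hIoc u ⟨hu.1, hu.2.le⟩]
    exact integrableOn_balayageKernel_mul hα hα1 hu.2 hσ
  · have hb : IntegrableOn (fun u => (t - u) ^ (α - 1) * ‖g u‖) (Ioc 0 σ) := by
      have h := intervalIntegrable_sub_rpow_mul_s11 hα (hσ0.le.trans hσ.le) hg.norm
      rw [intervalIntegrable_iff_integrableOn_Ioc_of_le (hσ0.le.trans hσ.le)] at h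
      exact h.mono_set (Ioc_subset_Ioc_right hσ.le)
    refine Integrable.congr hb ?_
    filter_upwards [hne] with u hu
    simp only [Function.uncurry_apply_pair, norm_mul]
    rw [MeasureTheory.integral_mul_const, ← setIntegral_balayageKernel_mul hα hα1 hu.2 hσ,
      ← hIoc u ⟨hu.1, hu.2.le⟩, ← setIntegral_indicator measurableSet_Ioi]
    congr 1
    refine setIntegral_congr_fun measurableSet_Ioc fun s hs => ?_
    refine (Real.norm_of_nonneg (indicator_apply_nonneg ?_)).symm
    intro hsu
    exact mul_nonneg (balayageKernel_nonneg hα hα1 hs.2 hσ)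
      (Real.rpow_nonneg (sub_nonneg.2 (le_of_lt hsu)) _)

open MeasureTheory in
/-- The truncated fractional integral `∫₀^σ (t-u)^(α-1) g(u) du` is a positive average of the
fractional integrals of `g` at earlier times. -/
theorem balayage_formula {α σ t : ℝ} (hα : 0 < α) (hα1 : α < 1)
    (hσ0 : 0 < σ) (hσ : σ < t) {g : ℝ → ℝ} (hg : ContinuousOn g (Icc 0 t)) :
    IntegrableOn (fun s => balayageKernel α σ t s * ∫ u in (0 : ℝ)..s, (s - u) ^ (α - 1) * g u)
        (Ioc 0 σ) ∧
      ∫ s in Ioc 0 σ, balayageKernel α σ t s * ∫ u in (0 : ℝ)..s, (s - u) ^ (α - 1) * g u =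
        ∫ u in (0 : ℝ)..σ, (t - u) ^ (α - 1) * g u := by
  have hint := integrable_balayageKernel_prod hα hα1 hσ0 hσ hg
  have hinner : ∀ s ∈ Ioc 0 σ, ∫ u in Ioc 0 σ,
      (Ioi u).indicator (fun s => balayageKernel α σ t s * (s - u) ^ (α - 1)) s * g u =
      balayageKernel α σ t s * ∫ u in (0 : ℝ)..s, (s - u) ^ (α - 1) * g u := fun s hs => by
    have hIoo : Ioc 0 σ ∩ Iio s = Ioo 0 s := by
      ext u
      simp only [mem_inter_iff, mem_Ioc, mem_Iio, mem_Ioo]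
      exact ⟨fun h => ⟨h.1.1, h.2⟩, fun h => ⟨⟨h.1, h.2.le.trans hs.2⟩, h.2⟩⟩
    rw [intervalIntegral.integral_of_le hs.1.le, integral_Ioc_eq_integral_Ioo (x := 0) (y := s), ← hIoo,
      ← setIntegral_indicator measurableSet_Iio, ← MeasureTheory.integral_const_mul]
    congr 1
    ext u
    by_cases h : u < s
    · simp [indicator, h, mul_assoc]
    · simp [indicator, h]
  have houter : ∫ u in Ioc 0 σ, ∫ s in Ioc 0 σ,
      (Ioi u).indicator (fun s => balayageKernel α σ t s * (s - u) ^ (α - 1)) s * g u =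
      ∫ u in (0 : ℝ)..σ, (t - u) ^ (α - 1) * g u := by
    rw [intervalIntegral.integral_of_le hσ0.le, integral_Ioc_eq_integral_Ioo,
      integral_Ioc_eq_integral_Ioo]
    refine setIntegral_congr_fun measurableSet_Ioo fun u hu => ?_
    rw [MeasureTheory.integral_mul_const, setIntegral_indicator measurableSet_Ioi, Ioc_inter_Ioi,
      sup_eq_right.2 hu.1.le, setIntegral_balayageKernel_mul hα hα1 hu.2 hσ]
  refine ⟨(integrableOn_congr_fun hinner measurableSet_Ioc).1 hint.integral_prod_right, ?_⟩
  rw [← houter, integral_integral_swap hint]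
  exact (setIntegral_congr_fun measurableSet_Ioc hinner).symm

/-- Extremum principle: if the fractional integral of a continuous function `g` on `[0,t]`
attains its minimum at the right endpoint `t > 0`, then `g t ≤ 0`. -/
theorem nonpos_of_fractionalIntegral_min {α t : ℝ} (hα : 0 < α) (hα1 : α ≤ 1) (ht : 0 < t)
    {g : ℝ → ℝ} (hg : ContinuousOn g (Icc 0 t))
    (hmin : ∀ s ∈ Icc 0 t, ∫ u in (0 : ℝ)..t, (t - u) ^ (α - 1) * g u ≤
      ∫ u in (0 : ℝ)..s, (s - u) ^ (α - 1) * g u) :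
    g t ≤ 0 := by
  by_contra! hgt
  obtain ⟨σ, hσ0, hσt, hpos⟩ : ∃ σ, 0 < σ ∧ σ < t ∧ ∀ s ∈ Ioc σ t, 0 < g s := by
    have h1 : ∀ᶠ s in nhdsWithin t (Iic t), 0 < g s := by
      have h2 : ContinuousWithinAt g (Iic t) t :=
        (hg t ⟨ht.le, le_rfl⟩).mono_of_mem_nhdsWithin (Icc_mem_nhdsLE ht)
      exact h2.eventually (lt_mem_nhds hgt)
    obtain ⟨l, hl, hlt⟩ := (mem_nhdsLE_iff_exists_Ioc_subset' ht).1 h1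
    refine ⟨max l (t / 2), by positivity, max_lt hl (by linarith), fun s hs => ?_⟩
    exact hlt ⟨(le_max_left _ _).trans_lt hs.1, hs.2⟩
  have hii := intervalIntegrable_sub_rpow_mul_s11 hα ht.le hg
  have hi1 := hii.mono_set (show uIcc 0 σ ⊆ uIcc 0 t by
    rw [uIcc_of_le hσ0.le, uIcc_of_le ht.le]
    exact Icc_subset_Icc_right hσt.le)
  have hi2 := hii.mono_set (show uIcc σ t ⊆ uIcc 0 t by
    rw [uIcc_of_le hσt.le, uIcc_of_le ht.le]
    exact Icc_subset_Icc_left hσ0.le)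
  have hsplit := intervalIntegral.integral_add_adjacent_intervals hi1 hi2
  have htail : 0 < ∫ u in σ..t, (t - u) ^ (α - 1) * g u :=
    intervalIntegral.intervalIntegral_pos_of_pos_on hi2 (fun u hu =>
      mul_pos (Real.rpow_pos_of_pos (sub_pos.2 hu.2) _) (hpos u ⟨hu.1, hu.2.le⟩)) hσt
  set I : ℝ → ℝ := fun s => ∫ u in (0 : ℝ)..s, (s - u) ^ (α - 1) * g u with hI
  have hhead : I t ≤ ∫ u in (0 : ℝ)..σ, (t - u) ^ (α - 1) * g u := by
    rcases hα1.lt_or_eq with hα1 | rfl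
    · obtain ⟨hint, heq⟩ := balayage_formula hα hα1 hσ0 hσt hg
      have hIt : I t ≤ 0 := by simpa using hmin 0 ⟨le_rfl, ht.le⟩
      calc I t ≤ (∫ s in Ioc 0 σ, balayageKernel α σ t s) * I t := by
            have := setIntegral_balayageKernel_le_one hα hα1 hσ0 hσt
            nlinarith
        _ = ∫ s in Ioc 0 σ, balayageKernel α σ t s * I t :=
            (MeasureTheory.integral_mul_const _ _).symm
        _ ≤ ∫ s in Ioc 0 σ, balayageKernel α σ t s * I s := by
            refine MeasureTheory.setIntegral_mono_on
              ((integrableOn_balayageKernel hα hα1 hσ0 hσt).mul_const _) hint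
              measurableSet_Ioc fun s hs => ?_
            exact mul_le_mul_of_nonneg_left (hmin s ⟨hs.1.le, hs.2.trans hσt.le⟩)
              (balayageKernel_nonneg hα hα1 hs.2 hσt)
        _ = _ := heq
    · simpa [hI] using hmin σ ⟨hσ0.le, hσt.le⟩
  have : I t = ∫ u in (0 : ℝ)..t, (t - u) ^ (α - 1) * g u := rfl
  linarith

/-- A function `w` with nonnegative initial value whose Caputo derivative `g` satisfies
`g ≥ -K |w|` stays nonnegative. -/
theorem nonneg_of_volterra {α t w₀ K : ℝ} (hα : 0 < α) (hα1 : α ≤ 1) (ht : 0 ≤ t) (hw₀ : 0 ≤ w₀)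
    (hK : 0 ≤ K) {w g : ℝ → ℝ} (hw : ContinuousOn w (Icc 0 t)) (hg : ContinuousOn g (Icc 0 t))
    (hwg : ∀ τ ∈ Icc 0 t,
      w τ = w₀ + (1 / Real.Gamma α) * ∫ s in (0 : ℝ)..τ, (τ - s) ^ (α - 1) * g s)
    (hgw : ∀ s ∈ Icc 0 t, -(K * |w s|) ≤ g s) :
    ∀ s ∈ Icc 0 t, 0 ≤ w s := by
  have hΓ : 0 < Real.Gamma α := Real.Gamma_pos_of_pos hα
  set e : ℝ → ℝ := fun s => mittagLeffler α ((K + 1) * s ^ α) with he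
  have hec : ContinuousOn e (Icc 0 t) := continuousOn_mittagLeffler_rpow hα (K + 1) t
  have hepos : ∀ s ∈ Icc 0 t, 0 < e s := fun s hs =>
    mittagLeffler_pos hα (mul_nonneg (by linarith) (Real.rpow_nonneg hs.1 _))
  -- Perturbing by a small multiple of `e` makes the bound on `g` strict.
  have key : ∀ ε > 0, ∀ s ∈ Icc 0 t, 0 < w s + ε * e s := by
    intro ε hε
    by_contra! hcon
    obtain ⟨s₁, hs₁, hs₁neg⟩ := hcon
    set v : ℝ → ℝ := fun s => w s + ε * e s with hv
    have hvc : ContinuousOn v (Icc 0 t) := hw.add (continuousOn_const.mul hec)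
    set G : ℝ → ℝ := fun s => g s + ε * ((K + 1) * e s) with hG
    have hGc : ContinuousOn G (Icc 0 t) :=
      hg.add (continuousOn_const.mul (continuousOn_const.mul hec))
    have hvG : ∀ τ ∈ Icc 0 t,
        v τ = (w₀ + ε) + (1 / Real.Gamma α) * ∫ s in (0 : ℝ)..τ, (τ - s) ^ (α - 1) * G s := by
      intro τ hτ
      have hsub : Icc 0 τ ⊆ Icc 0 t := Icc_subset_Icc_right hτ.2
      have hadd : ∫ s in (0 : ℝ)..τ, (τ - s) ^ (α - 1) * G s =
          (∫ s in (0 : ℝ)..τ, (τ - s) ^ (α - 1) * g s) +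
            ε * ∫ s in (0 : ℝ)..τ, (τ - s) ^ (α - 1) * ((K + 1) * e s) := by
        have hKe : ContinuousOn (fun s => (K + 1) * e s) (Icc 0 τ) :=
          continuousOn_const.mul (hec.mono hsub)
        rw [← intervalIntegral.integral_const_mul, ← intervalIntegral.integral_add
          (intervalIntegrable_sub_rpow_mul_s11 hα hτ.1 (hg.mono hsub))
          ((intervalIntegrable_sub_rpow_mul_s11 hα hτ.1 hKe).const_mul _)]
        refine intervalIntegral.integral_congr fun s _ => ?_
        simp only [hG]
        ring
      have heτ := mittagLeffler_rpow_eq hα (K + 1) hτ.1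
      rw [hadd]
      simp only [hv]
      rw [hwg τ hτ]
      simp only [he] at heτ ⊢
      linear_combination ε * heτ
    have hv0 : 0 < v 0 := by
      rw [hvG 0 ⟨le_rfl, ht⟩]
      simp
      linarith
    have hcl : IsClosed (Icc 0 t ∩ v ⁻¹' Iic 0) :=
      hvc.preimage_isClosed_of_isClosed isClosed_Icc isClosed_Iic
    obtain ⟨t₁, ⟨ht₁, ht₁v⟩, hleast⟩ :=
      (isCompact_Icc.of_isClosed_subset hcl inter_subset_left).exists_isLeast ⟨s₁, hs₁, hs₁neg⟩
    have ht₁v : v t₁ ≤ 0 := ht₁v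
    have ht₁pos : 0 < t₁ := by
      rcases ht₁.1.eq_or_lt with h | h
      · rw [← h] at ht₁v
        linarith
      · exact h
    have hsub : Icc 0 t₁ ⊆ Icc 0 t := Icc_subset_Icc_right ht₁.2
    have hzero : v t₁ = 0 := by
      obtain ⟨c, hc, hc0⟩ := intermediate_value_Icc' ht₁.1 (hvc.mono hsub) ⟨ht₁v, hv0.le⟩
      have := hleast ⟨hsub hc, hc0.le⟩
      rw [le_antisymm this hc.2, hc0]
    have hvnn : ∀ s ∈ Icc 0 t₁, v t₁ ≤ v s := by
      intro s hs
      by_contra! h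
      have := hleast ⟨hsub hs, show v s ≤ 0 by linarith⟩
      rw [le_antisymm this hs.2] at h
      exact lt_irrefl _ h
    have hGle : G t₁ ≤ 0 := by
      refine nonpos_of_fractionalIntegral_min hα hα1 ht₁pos (hGc.mono hsub) fun s hs => ?_
      have h1 := hvnn s hs
      rw [hvG s (hsub hs), hvG t₁ ht₁, add_le_add_iff_left] at h1
      exact le_of_mul_le_mul_left h1 (by positivity)
    have hwt : w t₁ = -(ε * e t₁) := by
      simp only [hv] at hzero
      linarith
    have hεe : 0 < ε * e t₁ := mul_pos hε (hepos t₁ ht₁)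
    have hgt := hgw t₁ ht₁
    rw [hwt, abs_neg, abs_of_pos hεe] at hgt
    simp only [hG] at hGle
    nlinarith
  intro s hs
  refine le_of_forall_pos_le_add fun δ hδ => ?_
  have h := key (δ / e s) (div_pos hδ (hepos s hs)) s hs
  rw [div_mul_cancel₀ _ (hepos s hs).ne'] at h
  exact h.le

/-- Comparison of two Volterra representations whose right-hand sides satisfy a one-sided
Lipschitz bound. -/
theorem le_of_volterra {α t x₀ K : ℝ} (hα : 0 < α) (hα1 : α ≤ 1) (ht : 0 ≤ t)
    (hK : 0 ≤ K) {u v p q : ℝ → ℝ} (hu : ContinuousOn u (Icc 0 t)) (hv : ContinuousOn v (Icc 0 t))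
    (hp : ContinuousOn p (Icc 0 t)) (hq : ContinuousOn q (Icc 0 t))
    (hup : ∀ τ ∈ Icc 0 t,
      u τ = x₀ + (1 / Real.Gamma α) * ∫ s in (0 : ℝ)..τ, (τ - s) ^ (α - 1) * p s)
    (hvq : ∀ τ ∈ Icc 0 t,
      v τ = x₀ + (1 / Real.Gamma α) * ∫ s in (0 : ℝ)..τ, (τ - s) ^ (α - 1) * q s)
    (hpq : ∀ s ∈ Icc 0 t, -(K * |v s - u s|) ≤ q s - p s) :
    ∀ s ∈ Icc 0 t, u s ≤ v s := by
  intro s hs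
  refine sub_nonneg.1 (nonneg_of_volterra (w := fun s => v s - u s) (g := fun s => q s - p s)
    hα hα1 ht le_rfl hK (hv.sub hu) (hq.sub hp) (fun τ hτ => ?_) hpq s hs)
  have hsub : Icc 0 τ ⊆ Icc 0 t := Icc_subset_Icc_right hτ.2
  simp only [mul_sub]
  rw [intervalIntegral.integral_sub (intervalIntegrable_sub_rpow_mul_s11 hα hτ.1 (hq.mono hsub))
    (intervalIntegrable_sub_rpow_mul_s11 hα hτ.1 (hp.mono hsub)), hup τ hτ, hvq τ hτ]
  ring

theorem const_mul_mittagLeffler_rpow_eq {α : ℝ} (hα : 0 < α) (x₀ c : ℝ) {t : ℝ} (ht : 0 ≤ t) :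
    x₀ * mittagLeffler α (c * t ^ α) = x₀ + (1 / Real.Gamma α) *
      ∫ s in (0 : ℝ)..t, (t - s) ^ (α - 1) * (c * (x₀ * mittagLeffler α (c * s ^ α))) := by
  have h : ∫ s in (0 : ℝ)..t, (t - s) ^ (α - 1) * (c * (x₀ * mittagLeffler α (c * s ^ α))) =
      x₀ * ∫ s in (0 : ℝ)..t, (t - s) ^ (α - 1) * (c * mittagLeffler α (c * s ^ α)) := by
    rw [← intervalIntegral.integral_const_mul]
    refine intervalIntegral.integral_congr fun s _ => ?_
    ring
  rw [h, mittagLeffler_rpow_eq hα c ht]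
  ring

/-- For a positive initial value `x₀ > 0`, the solution `φ(·,x₀)` satisfies
`x₀·E_α(a_*(t)·t^α) ≤ φ(t,x₀) ≤ x₀·E_α(a^*(t)·t^α)` on `[0,T]`. -/
theorem caputo_nonlinear_bounds_pos (α T : ℝ) (hα : 0 < α) (hα1 : α ≤ 1) (hT : 0 < T)
    (f : ℝ → ℝ → ℝ)
    (hf : ContinuousOn (fun p : ℝ × ℝ => f p.1 p.2) (Set.Icc 0 T ×ˢ Set.univ))
    (L : ℝ → ℝ) (hLc : ContinuousOn L (Set.Icc 0 T))
    (hLnn : ∀ t ∈ Set.Icc 0 T, 0 ≤ L t)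
    (hLip : ∀ t ∈ Set.Icc 0 T, ∀ x y : ℝ, |f t x - f t y| ≤ L t * |x - y|)
    (hf0 : ∀ t ∈ Set.Icc 0 T, f t 0 = 0)
    (x₀ : ℝ) (hx₀ : 0 < x₀) (φ : ℝ → ℝ) (hφ : IsCaputoSolution α T f x₀ φ) :
    ∀ t ∈ Set.Icc 0 T,
      x₀ * mittagLeffler α (aLow f t * t ^ α) ≤ φ t ∧
        φ t ≤ x₀ * mittagLeffler α (aHigh f t * t ^ α) := by
  intro t ht
  obtain ⟨hφc, hφeq⟩ := hφ
  have hsub : Icc 0 t ⊆ Icc 0 T := Icc_subset_Icc_right ht.2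
  obtain ⟨M, hM⟩ := (isCompact_Icc.bddAbove_image hLc)
  have hLM : ∀ s ∈ Icc 0 T, L s ≤ M := fun s hs => hM (mem_image_of_mem L hs)
  have hM0 : 0 ≤ M := (hLnn t ht).trans (hLM t ht)
  have hfbd : ∀ s ∈ Icc 0 T, ∀ x, |f s x| ≤ M * |x| := fun s hs x => by
    have h := hLip s hs x 0
    rw [hf0 s hs, sub_zero, sub_zero] at h
    exact h.trans (mul_le_mul_of_nonneg_right (hLM s hs) (abs_nonneg x))
  have hquot : ∀ y ∈ {y | ∃ s ∈ Icc 0 t, ∃ x : ℝ, x ≠ 0 ∧ y = f s x / x}, |y| ≤ M := by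
    rintro y ⟨s, hs, x, hx, rfl⟩
    rw [abs_div, div_le_iff₀ (abs_pos.2 hx)]
    exact hfbd s (hsub hs) x
  have hbelow : BddBelow {y | ∃ s ∈ Icc 0 t, ∃ x : ℝ, x ≠ 0 ∧ y = f s x / x} :=
    ⟨-M, fun y hy => (abs_le.1 (hquot y hy)).1⟩
  have habove : BddAbove {y | ∃ s ∈ Icc 0 t, ∃ x : ℝ, x ≠ 0 ∧ y = f s x / x} :=
    ⟨M, fun y hy => (abs_le.1 (hquot y hy)).2⟩
  have hφt : ContinuousOn φ (Icc 0 t) := hφc.mono hsub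
  have hgc : ContinuousOn (fun s => f s (φ s)) (Icc 0 t) :=
    hf.comp (continuousOn_id.prodMk hφt) fun s hs => ⟨hsub hs, mem_univ _⟩
  have hφV : ∀ τ ∈ Icc 0 t, φ τ = x₀ + (1 / Real.Gamma α) *
      ∫ s in (0 : ℝ)..τ, (τ - s) ^ (α - 1) * f s (φ s) := fun τ hτ => hφeq τ (hsub hτ)
  have hφnn : ∀ s ∈ Icc 0 t, 0 ≤ φ s :=
    nonneg_of_volterra hα hα1 ht.1 hx₀.le hM0 hφt hgc hφV
      fun s hs => neg_le_of_abs_le (hfbd s (hsub hs) _)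
  have hlow : ∀ s ∈ Icc 0 t, aLow f t * φ s ≤ f s (φ s) := fun s hs => by
    rcases (hφnn s hs).eq_or_lt with h | h
    · rw [← h, hf0 s (hsub hs), mul_zero]
    · rw [← le_div_iff₀ h]
      exact csInf_le hbelow ⟨s, hs, φ s, h.ne', rfl⟩
  have hhigh : ∀ s ∈ Icc 0 t, f s (φ s) ≤ aHigh f t * φ s := fun s hs => by
    rcases (hφnn s hs).eq_or_lt with h | h
    · rw [← h, hf0 s (hsub hs), mul_zero]
    · rw [← div_le_iff₀ h]
      exact le_csSup habove ⟨s, hs, φ s, h.ne', rfl⟩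
  have hE (c : ℝ) : ContinuousOn (fun s => x₀ * mittagLeffler α (c * s ^ α)) (Icc 0 t) :=
    continuousOn_const.mul (continuousOn_mittagLeffler_rpow hα c t)
  have hEV (c : ℝ) : ∀ τ ∈ Icc 0 t, x₀ * mittagLeffler α (c * τ ^ α) = x₀ + (1 / Real.Gamma α) *
      ∫ s in (0 : ℝ)..τ, (τ - s) ^ (α - 1) * (c * (x₀ * mittagLeffler α (c * s ^ α))) :=
    fun τ hτ => const_mul_mittagLeffler_rpow_eq hα x₀ c hτ.1
  have habs (c z : ℝ) : -(|c| * |z|) ≤ c * z := by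
    rw [← abs_mul]
    exact neg_abs_le _
  constructor
  · refine le_of_volterra hα hα1 ht.1 (abs_nonneg (aLow f t)) (hE _) hφt
      (continuousOn_const.mul (hE _)) hgc (hEV _) hφV (fun s hs => ?_) t ⟨ht.1, le_rfl⟩
    refine (habs _ _).trans ?_
    rw [mul_sub]
    exact sub_le_sub_right (hlow s hs) _
  · refine le_of_volterra hα hα1 ht.1 (abs_nonneg (aHigh f t)) hφt (hE _)
      hgc (continuousOn_const.mul (hE _)) hφV (hEV _) (fun s hs => ?_) t ⟨ht.1, le_rfl⟩
    refine (habs _ _).trans ?_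
    rw [mul_sub]
    exact sub_le_sub_left (hhigh s hs) _
end
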